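/- Let τ ∈ ℝ, a < b be real numbers, Ω ⊆ ℝ × (a, b) a convex open domain, and φ: ∂Ω → ℝ a continuous function with m < φ < M on ∂Ω for some constants m, M. If u, v ∈ C²(Ω) ∩ C⁰(Ω̄) both satisfy the Nil₃(τ) minimal graph equation on Ω and u = v = φ on ∂Ω, then u = v on Ω; moreover any such solution satisfies m < u < M on Ω. -/

import Mathlib

noncomputable section

/-- `α = ∂ₓu + τy` in the Heisenberg group model `Nil₃(τ)`. -/
def nilAlpha (τ : ℝ) (u : ℝ × ℝ → ℝ) (p : ℝ × ℝ) : ℝ :=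
  fderiv ℝ u p (1, 0) + τ * p.2

/-- `β = ∂_yu − τx` in the Heisenberg group model `Nil₃(τ)`. -/
def nilBeta (τ : ℝ) (u : ℝ × ℝ → ℝ) (p : ℝ × ℝ) : ℝ :=
  fderiv ℝ u p (0, 1) - τ * p.1

/-- The area element `W = √(1 + α² + β²)`. -/
def nilW (τ : ℝ) (u : ℝ × ℝ → ℝ) (p : ℝ × ℝ) : ℝ :=
  Real.sqrt (1 + nilAlpha τ u p ^ 2 + nilBeta τ u p ^ 2)

/-- The `Nil₃(τ)` minimal graph equation `∂ₓ(α/W) + ∂_y(β/W) = 0` on `Ω`. -/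
def NilMinimal (τ : ℝ) (u : ℝ × ℝ → ℝ) (Ω : Set (ℝ × ℝ)) : Prop :=
  ∀ p ∈ Ω,
    fderiv ℝ (fun q => nilAlpha τ u q / nilW τ u q) p (1, 0) +
      fderiv ℝ (fun q => nilBeta τ u q / nilW τ u q) p (0, 1) = 0

lemma nilW_pos (τ : ℝ) (u : ℝ × ℝ → ℝ) (p : ℝ × ℝ) : 0 < nilW τ u p :=
  Real.sqrt_pos.2 (by positivity)

lemma nilW_sq (τ : ℝ) (u : ℝ × ℝ → ℝ) (p : ℝ × ℝ) :
    nilW τ u p ^ 2 = 1 + nilAlpha τ u p ^ 2 + nilBeta τ u p ^ 2 :=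
  Real.sq_sqrt (by positivity)

lemma contDiffAt_nilAlpha {τ : ℝ} {u : ℝ × ℝ → ℝ} {p : ℝ × ℝ} (hu : ContDiffAt ℝ 2 u p) :
    ContDiffAt ℝ 1 (nilAlpha τ u) p := by
  have h : ContDiffAt ℝ 1 (fderiv ℝ u) p := hu.fderiv_right (by norm_num)
  unfold nilAlpha
  fun_prop

lemma contDiffAt_nilBeta {τ : ℝ} {u : ℝ × ℝ → ℝ} {p : ℝ × ℝ} (hu : ContDiffAt ℝ 2 u p) :
    ContDiffAt ℝ 1 (nilBeta τ u) p := by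
  have h : ContDiffAt ℝ 1 (fderiv ℝ u) p := hu.fderiv_right (by norm_num)
  unfold nilBeta
  fun_prop

lemma contDiffAt_nilW {τ : ℝ} {u : ℝ × ℝ → ℝ} {p : ℝ × ℝ} (hu : ContDiffAt ℝ 2 u p) :
    ContDiffAt ℝ 1 (nilW τ u) p := by
  have h1 := contDiffAt_nilAlpha (τ := τ) hu
  have h2 := contDiffAt_nilBeta (τ := τ) hu
  unfold nilW
  exact ContDiffAt.sqrt (by fun_prop) (by positivity)

lemma contDiffAt_nilAlpha_div {τ : ℝ} {u : ℝ × ℝ → ℝ} {p : ℝ × ℝ} (hu : ContDiffAt ℝ 2 u p) :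
    ContDiffAt ℝ 1 (fun q => nilAlpha τ u q / nilW τ u q) p :=
  (contDiffAt_nilAlpha hu).div (contDiffAt_nilW hu) (nilW_pos τ u p).ne'

lemma contDiffAt_nilBeta_div {τ : ℝ} {u : ℝ × ℝ → ℝ} {p : ℝ × ℝ} (hu : ContDiffAt ℝ 2 u p) :
    ContDiffAt ℝ 1 (fun q => nilBeta τ u q / nilW τ u q) p :=
  (contDiffAt_nilBeta hu).div (contDiffAt_nilW hu) (nilW_pos τ u p).ne'

/-- The second derivative of `u` at `p` in the directions `d` and `e`. -/
def secondDeriv (u : ℝ × ℝ → ℝ) (p d e : ℝ × ℝ) : ℝ := fderiv ℝ (fderiv ℝ u) p d e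

/-- The minimal graph operator in non-divergence form. -/
lemma nil_divergence_eq {τ : ℝ} {u : ℝ × ℝ → ℝ} {p : ℝ × ℝ} (hu : ContDiffAt ℝ 2 u p) :
    fderiv ℝ (fun q => nilAlpha τ u q / nilW τ u q) p (1, 0) +
      fderiv ℝ (fun q => nilBeta τ u q / nilW τ u q) p (0, 1) =
    (secondDeriv u p (1, 0) (1, 0) + secondDeriv u p (0, 1) (0, 1) +
      secondDeriv u p (nilBeta τ u p, -nilAlpha τ u p) (nilBeta τ u p, -nilAlpha τ u p)) /
        nilW τ u p ^ 3 := by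
  have hD : HasFDerivAt (fderiv ℝ u) (fderiv ℝ (fderiv ℝ u) p) p :=
    ((hu.fderiv_right (m := 1) (by norm_num)).differentiableAt (by norm_num)).hasFDerivAt
  set H := fderiv ℝ (fderiv ℝ u) p with hH
  have hα : HasFDerivAt (nilAlpha τ u) ((ContinuousLinearMap.apply ℝ ℝ ((1, 0) : ℝ × ℝ)).comp H +
      τ • ContinuousLinearMap.snd ℝ ℝ ℝ) p :=
    ((ContinuousLinearMap.apply ℝ ℝ ((1, 0) : ℝ × ℝ)).hasFDerivAt.comp p hD).add
      (hasFDerivAt_snd.const_mul τ)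
  have hβ : HasFDerivAt (nilBeta τ u) ((ContinuousLinearMap.apply ℝ ℝ ((0, 1) : ℝ × ℝ)).comp H -
      τ • ContinuousLinearMap.fst ℝ ℝ ℝ) p :=
    ((ContinuousLinearMap.apply ℝ ℝ ((0, 1) : ℝ × ℝ)).hasFDerivAt.comp p hD).sub
      (hasFDerivAt_fst.const_mul τ)
  have hWpos := nilW_pos τ u p
  have hWs := nilW_sq τ u p
  have hW : HasFDerivAt (nilW τ u) ((nilW τ u p)⁻¹ • (nilAlpha τ u p •
      ((ContinuousLinearMap.apply ℝ ℝ ((1, 0) : ℝ × ℝ)).comp H + τ • ContinuousLinearMap.snd ℝ ℝ ℝ) +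
      nilBeta τ u p • ((ContinuousLinearMap.apply ℝ ℝ ((0, 1) : ℝ × ℝ)).comp H -
      τ • ContinuousLinearMap.fst ℝ ℝ ℝ))) p := by
    have := HasFDerivAt.sqrt (((hα.pow 2).const_add 1).fun_add (hβ.pow 2))
      (by positivity)
    have hw : √(1 + nilAlpha τ u p ^ 2 + nilBeta τ u p ^ 2) = nilW τ u p := rfl
    rw [hw] at this
    refine this.congr_fderiv ?_
    ext <;> simp <;> field_simp
  have hWi := (hasDerivAt_inv hWpos.ne').comp_hasFDerivAt p hW
  have h1 := hα.fun_mul hWi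
  have h2 := hβ.fun_mul hWi
  have e1 : fderiv ℝ (fun q => nilAlpha τ u q / nilW τ u q) p = _ := h1.fderiv
  have e2 : fderiv ℝ (fun q => nilBeta τ u q / nilW τ u q) p = _ := h2.fderiv
  have hsymm : H (1, 0) (0, 1) = H (0, 1) (1, 0) :=
    (hu.isSymmSndFDerivAt (by simp)).eq _ _
  have hd : ((nilBeta τ u p, -nilAlpha τ u p) : ℝ × ℝ) =
      nilBeta τ u p • ((1, 0) : ℝ × ℝ) + (-nilAlpha τ u p) • ((0, 1) : ℝ × ℝ) := by
    ext <;> simp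
  rw [e1, e2]
  simp only [secondDeriv, ← hH]
  rw [hd]
  simp only [map_add, map_smul, add_apply, sub_apply, smul_apply, ContinuousLinearMap.comp_apply,
    ContinuousLinearMap.apply_apply, ContinuousLinearMap.coe_fst', ContinuousLinearMap.coe_snd',
    smul_eq_mul, hsymm, Function.comp_apply]
  generalize nilW τ u p = w at *
  generalize nilAlpha τ u p = α at *
  generalize nilBeta τ u p = β at *
  field_simp
  rw [hWs]
  ring

lemma NilMinimal.secondDeriv_eq_zero {τ : ℝ} {u : ℝ × ℝ → ℝ} {Ω : Set (ℝ × ℝ)}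
    (h : NilMinimal τ u Ω) {p : ℝ × ℝ} (hp : p ∈ Ω) (hu : ContDiffAt ℝ 2 u p) :
    secondDeriv u p (1, 0) (1, 0) + secondDeriv u p (0, 1) (0, 1) +
      secondDeriv u p (nilBeta τ u p, -nilAlpha τ u p) (nilBeta τ u p, -nilAlpha τ u p) = 0 := by
  have h1 := h p hp
  rw [nil_divergence_eq hu, div_eq_zero_iff] at h1
  exact h1.resolve_right (pow_pos (nilW_pos τ u p) 3).ne'

lemma nonpos_of_isLocalMax_of_hasDerivAt {g g' : ℝ → ℝ} {c : ℝ} (hmax : IsLocalMax g 0)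
    (hg : ∀ᶠ t in nhds 0, HasDerivAt g (g' t) t) (hg' : HasDerivAt g' c 0) : c ≤ 0 := by
  by_contra! hc
  have h0 : g' 0 = 0 := hmax.hasDerivAt_eq_zero hg.self_of_nhds
  have hd : deriv g =ᶠ[nhds 0] g' := hg.mono fun t ht => ht.deriv
  have hmin : IsLocalMin g 0 := isLocalMin_of_deriv_deriv_pos
    (by rw [hd.deriv_eq, hg'.deriv]; exact hc) (by rw [hd.self_of_nhds, h0])
    hg.self_of_nhds.continuousAt
  have hconst : g =ᶠ[nhds 0] fun _ => g 0 := by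
    filter_upwards [hmax, hmin] with t h1 h2 using le_antisymm h1 h2
  have h2 : g' =ᶠ[nhds 0] fun _ => 0 := by
    filter_upwards [hg, hconst.eventuallyEq_nhds] with t h1 h2
    exact h1.unique ((hasDerivAt_const t (g 0)).congr_of_eventuallyEq h2)
  have := hg'.unique ((hasDerivAt_const 0 (0 : ℝ)).congr_of_eventuallyEq h2)
  exact hc.ne' this

/-- `B` has gradient `(b₁, b₂)` and Hessian `(b₁₁, b₁₂; b₁₂, b₂₂)` at `p`, tested along lines. -/
def HasLineJet (B : ℝ × ℝ → ℝ) (p : ℝ × ℝ) (b₁ b₂ b₁₁ b₁₂ b₂₂ : ℝ) : Prop :=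
  ∀ d : ℝ × ℝ, ∃ g' : ℝ → ℝ, (∀ᶠ t in nhds (0 : ℝ), HasDerivAt (fun t => B (p + t • d)) (g' t) t) ∧
    g' 0 = d.1 * b₁ + d.2 * b₂ ∧
    HasDerivAt g' (d.1 ^ 2 * b₁₁ + 2 * d.1 * d.2 * b₁₂ + d.2 ^ 2 * b₂₂) 0

lemma hasDerivAt_line (p d : ℝ × ℝ) (t : ℝ) : HasDerivAt (fun t : ℝ => p + t • d) d t := by
  simpa using ((hasDerivAt_id t).smul_const d).const_add p

lemma nil_touching {τ : ℝ} {u B : ℝ × ℝ → ℝ} {Ω : Set (ℝ × ℝ)} {p : ℝ × ℝ}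
    (h : NilMinimal τ u Ω) (hp : p ∈ Ω) (hu : ContDiffAt ℝ 2 u p) {b₁ b₂ b₁₁ b₁₂ b₂₂ : ℝ}
    (hB : HasLineJet B p b₁ b₂ b₁₁ b₁₂ b₂₂) (hmax : IsLocalMax (fun q => u q - B q) p) :
    fderiv ℝ u p (1, 0) = b₁ ∧ fderiv ℝ u p (0, 1) = b₂ ∧
      0 ≤ (1 + nilBeta τ u p ^ 2) * b₁₁ - 2 * nilAlpha τ u p * nilBeta τ u p * b₁₂ +
        (1 + nilAlpha τ u p ^ 2) * b₂₂ := by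
  have hline : ∀ d : ℝ × ℝ, fderiv ℝ u p d = d.1 * b₁ + d.2 * b₂ ∧
      secondDeriv u p d d ≤ d.1 ^ 2 * b₁₁ + 2 * d.1 * d.2 * b₁₂ + d.2 ^ 2 * b₂₂ := by
    intro d
    obtain ⟨g', hg', h0, hg''⟩ := hB d
    have hc : Filter.Tendsto (fun t : ℝ => p + t • d) (nhds 0) (nhds p) := by
      have : ContinuousAt (fun t : ℝ => p + t • d) 0 := (hasDerivAt_line p d 0).continuousAt
      simpa [ContinuousAt] using this
    have hmax' : IsLocalMax (fun t : ℝ => u (p + t • d) - B (p + t • d)) 0 := by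
      have := hc.eventually hmax
      simpa [IsLocalMax, IsMaxFilter] using this
    have hu' : ∀ᶠ t in nhds (0 : ℝ),
        HasDerivAt (fun t : ℝ => u (p + t • d)) (fderiv ℝ u (p + t • d) d) t := by
      filter_upwards [hc.eventually (hu.eventually (by simp))] with t ht
      exact (ht.differentiableAt (by norm_num)).hasFDerivAt.comp_hasDerivAt t (hasDerivAt_line p d t)
    have hH : HasFDerivAt (fderiv ℝ u) (fderiv ℝ (fderiv ℝ u) p) p :=
      ((hu.fderiv_right (m := 1) (by norm_num)).differentiableAt (by norm_num)).hasFDerivAt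
    have hu'' : HasDerivAt (fun t : ℝ => fderiv ℝ u (p + t • d) d) (secondDeriv u p d d) 0 := by
      have h1 : HasFDerivAt (fderiv ℝ u) (fderiv ℝ (fderiv ℝ u) p) (p + (0 : ℝ) • d) := by
        simpa using hH
      have h2 := h1.comp_hasDerivAt (0 : ℝ) (hasDerivAt_line p d 0)
      exact (ContinuousLinearMap.apply ℝ ℝ d).hasFDerivAt.comp_hasDerivAt (0 : ℝ) h2
    have hdiff : ∀ᶠ t in nhds (0 : ℝ), HasDerivAt (fun t : ℝ => u (p + t • d) - B (p + t • d))
        (fderiv ℝ u (p + t • d) d - g' t) t := by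
      filter_upwards [hu', hg'] with t h1 h2 using h1.sub h2
    have h1 := hmax'.hasDerivAt_eq_zero hdiff.self_of_nhds
    have h2 := nonpos_of_isLocalMax_of_hasDerivAt hmax' hdiff (hu''.sub hg'')
    simp only [zero_smul, add_zero, h0] at h1
    exact ⟨by linarith, by linarith⟩
  have hz := h.secondDeriv_eq_zero hp hu
  have h1 := hline (1, 0)
  have h2 := hline (0, 1)
  have h3 := (hline (nilBeta τ u p, -nilAlpha τ u p)).2
  simp only at h1 h2 h3
  refine ⟨by linarith [h1.1], by linarith [h2.1], ?_⟩
  nlinarith [h1.2, h2.2]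

lemma hasLineJet_mul_add {f f' g g' : ℝ → ℝ} {f'' g'' τ : ℝ} {p : ℝ × ℝ}
    (hf : ∀ᶠ x in nhds p.1, HasDerivAt f (f' x) x) (hf' : HasDerivAt f' f'' p.1)
    (hg : ∀ᶠ y in nhds p.2, HasDerivAt g (g' y) y) (hg' : HasDerivAt g' g'' p.2) :
    HasLineJet (fun q => τ * q.1 * q.2 + f q.1 + g q.2) p (τ * p.2 + f' p.1) (τ * p.1 + g' p.2)
      f'' τ g'' := by
  intro d
  have hx : ∀ t : ℝ, HasDerivAt (fun t : ℝ => p.1 + t * d.1) d.1 t := fun t => by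
    simpa using ((hasDerivAt_id t).mul_const d.1).const_add p.1
  have hy : ∀ t : ℝ, HasDerivAt (fun t : ℝ => p.2 + t * d.2) d.2 t := fun t => by
    simpa using ((hasDerivAt_id t).mul_const d.2).const_add p.2
  have cx : Filter.Tendsto (fun t : ℝ => p.1 + t * d.1) (nhds 0) (nhds p.1) := by
    have : ContinuousAt (fun t : ℝ => p.1 + t * d.1) 0 := (hx 0).continuousAt
    simpa [ContinuousAt] using this
  have cy : Filter.Tendsto (fun t : ℝ => p.2 + t * d.2) (nhds 0) (nhds p.2) := by
    have : ContinuousAt (fun t : ℝ => p.2 + t * d.2) 0 := (hy 0).continuousAt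
    simpa [ContinuousAt] using this
  refine ⟨fun t => τ * (d.1 * (p.2 + t * d.2) + (p.1 + t * d.1) * d.2) +
    f' (p.1 + t * d.1) * d.1 + g' (p.2 + t * d.2) * d.2, ?_, ?_, ?_⟩
  · filter_upwards [cx.eventually hf, cy.eventually hg] with t h1 h2
    have := ((((hx t).mul (hy t)).const_mul τ).add (h1.comp t (hx t))).add (h2.comp t (hy t))
    refine (this.congr_deriv (by ring)).congr_of_eventuallyEq (Filter.Eventually.of_forall ?_)
    intro s
    simp [mul_assoc]
  · simp only [zero_mul, add_zero]; ring
  · have h1 : HasDerivAt f' f'' (p.1 + 0 * d.1) := by simpa using hf'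
    have h2 : HasDerivAt g' g'' (p.2 + 0 * d.2) := by simpa using hg'
    have := (((((hy 0).const_mul d.1).add ((hx 0).mul_const d.2)).const_mul τ).add
      ((h1.comp 0 (hx 0)).mul_const d.1)).add ((h2.comp 0 (hy 0)).mul_const d.2)
    exact this.congr_deriv (by ring)

/-- The sign condition making `τxy + f(x) + g(y)` a strict supersolution, where `f'' = c(1 + f'²)`,
`g' = e`, `g'' = -(|τ| + 1)e` and `s = f' + 2τy`. -/
lemma barrier_neg {τ T κ c f₁ f₂ e t : ℝ} (he1 : κ ≤ e) (he2 : e ≤ 1) (hκ : 0 < κ)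
    (ht : |t| ≤ T) (hc : c = κ / (8 * (1 + T ^ 2))) (hf : f₂ = c * (1 + f₁ ^ 2)) :
    (1 + e ^ 2) * f₂ - 2 * (f₁ + t) * e * τ + (1 + (f₁ + t) ^ 2) * (-(|τ| + 1) * e) < 0 := by
  set s := f₁ + t with hs
  have ht2 : t ^ 2 ≤ T ^ 2 := sq_le_sq' (abs_le.1 ht).1 (abs_le.1 ht).2
  have hT : 0 < 1 + T ^ 2 := by positivity
  have hc0 : 0 < c := by rw [hc]; positivity
  have hcT : c * (8 * (1 + T ^ 2)) = κ := by rw [hc]; field_simp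
  have h1 : 1 + f₁ ^ 2 ≤ 2 * (1 + T ^ 2) * (1 + s ^ 2) := by
    have : f₁ = s - t := by ring
    nlinarith [sq_nonneg (s + t), mul_nonneg (sq_nonneg T) (sq_nonneg s)]
  have he : 0 < e := hκ.trans_le he1
  have h2 : f₂ ≤ c * (2 * (1 + T ^ 2) * (1 + s ^ 2)) := by
    rw [hf]; exact mul_le_mul_of_nonneg_left h1 hc0.le
  have h3 : (1 + e ^ 2) * f₂ ≤ 2 * (c * (2 * (1 + T ^ 2) * (1 + s ^ 2))) := by
    have h0 : 0 ≤ f₂ := by rw [hf]; positivity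
    have h6 : 1 + e ^ 2 ≤ 2 := by nlinarith
    have h7 := mul_le_mul_of_nonneg_right h6 h0
    linarith
  have h4 : 2 * (c * (2 * (1 + T ^ 2) * (1 + s ^ 2))) = κ / 2 * (1 + s ^ 2) := by
    rw [← hcT]; ring
  have h5 : -(2 * s * τ) ≤ |τ| * (1 + s ^ 2) := by
    have h6 : -(s * τ) ≤ |s| * |τ| := by rw [← abs_mul]; exact neg_le_abs _
    have h7 : 2 * |s| ≤ 1 + s ^ 2 := by nlinarith [sq_nonneg (|s| - 1), sq_abs s]
    nlinarith [abs_nonneg τ]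
  have h8 := mul_le_mul_of_nonneg_left h5 he.le
  have h9 : κ * (1 + s ^ 2) ≤ e * (1 + s ^ 2) := by gcongr
  nlinarith [mul_pos hκ (by positivity : 0 < 1 + s ^ 2)]

lemma hasDerivAt_neg_log_cos {c x₀ x : ℝ} (hc : 0 < c) (h : |x - x₀| < Real.pi / (2 * c)) :
    HasDerivAt (fun x => -(Real.log (Real.cos (c * (x - x₀))) / c)) (Real.tan (c * (x - x₀))) x ∧
    HasDerivAt (fun x => Real.tan (c * (x - x₀))) (c * (1 + Real.tan (c * (x - x₀)) ^ 2)) x ∧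
    0 < Real.cos (c * (x - x₀)) := by
  have h1 : |c * (x - x₀)| < Real.pi / 2 := by
    rw [abs_mul, abs_of_pos hc]
    calc c * |x - x₀| < c * (Real.pi / (2 * c)) := by gcongr
      _ = Real.pi / 2 := by field_simp
  have hcos : 0 < Real.cos (c * (x - x₀)) := Real.cos_pos_of_mem_Ioo (abs_lt.1 h1)
  have hl : HasDerivAt (fun x => c * (x - x₀)) c x := by
    simpa using ((hasDerivAt_id x).sub_const x₀).const_mul c
  refine ⟨?_, ?_, hcos⟩
  · have := ((hl.cos.log hcos.ne').div_const c).neg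
    refine this.congr_deriv ?_
    rw [Real.tan_eq_sin_div_cos]
    field_simp
  · have := (Real.hasDerivAt_tan hcos.ne').comp x hl
    refine this.congr_deriv ?_
    rw [Real.tan_eq_sin_div_cos]
    field_simp
    rw [add_comm, Real.sin_sq_add_cos_sq]

lemma nil_le_add_linear {τ a b M : ℝ} {Ω : Set (ℝ × ℝ)} (hΩo : IsOpen Ω)
    (hΩs : Ω ⊆ {p : ℝ × ℝ | p.2 ∈ Set.Ioo a b}) {u : ℝ × ℝ → ℝ} (hu : ContDiffOn ℝ 2 u Ω)
    (hu0 : ContinuousOn u (closure Ω)) (humin : NilMinimal τ u Ω)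
    (hM : ∀ p ∈ frontier Ω, u p ≤ M) :
    ∃ C : ℝ, 0 < C ∧ ∀ p ∈ Ω, u p ≤ M + C * (1 + |τ| * |p.1|) := by
  have hcl : closure Ω ⊆ {p : ℝ × ℝ | p.2 ∈ Set.Icc a b} :=
    closure_minimal (hΩs.trans fun p hp => ⟨hp.1.le, hp.2.le⟩)
      (isClosed_Icc.preimage continuous_snd)
  set Y := max |a| |b| with hY
  have hYnn : 0 ≤ Y := (abs_nonneg a).trans (le_max_left _ _)
  have hYb : ∀ y ∈ Set.Icc a b, |y| ≤ Y := fun y hy => abs_le_max_abs_abs hy.1 hy.2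
  set k := |τ| + 1 with hk
  have hk1 : 1 ≤ k := by rw [hk]; linarith [abs_nonneg τ]
  have hk0 : 0 < k := by linarith
  set κ := Real.exp (-(k * (b - a))) with hκ
  have hκ0 : 0 < κ := Real.exp_pos _
  set T := 2 * |τ| * Y with hT
  set c := κ / (8 * (1 + T ^ 2)) with hc
  have hc0 : 0 < c := by positivity
  set L := Real.pi / (2 * c) with hL
  have hL0 : 0 < L := by positivity
  refine ⟨max (|τ| * L * Y + 1) (2 * Y), lt_of_lt_of_le (by positivity) (le_max_left _ _), ?_⟩
  rintro ⟨x₀, y₀⟩ hp₀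
  set f : ℝ → ℝ := fun x => -(Real.log (Real.cos (c * (x - x₀))) / c) with hf
  set g : ℝ → ℝ := fun y => -(Real.exp (-(k * (y - a))) / k) with hg
  set K := M + |τ| * (|x₀| + L) * Y + 1 with hK
  have hg' : ∀ y, HasDerivAt g (Real.exp (-(k * (y - a)))) y := by
    intro y
    have hl : HasDerivAt (fun y => -(k * (y - a))) (-k) y := by
      simpa using (((hasDerivAt_id y).sub_const a).const_mul k).fun_neg
    refine (hl.exp.div_const k).neg.congr_deriv ?_
    field_simp
  have hg'' : ∀ y, HasDerivAt (fun y => Real.exp (-(k * (y - a))))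
      (-(|τ| + 1) * Real.exp (-(k * (y - a)))) y := by
    intro y
    have hl : HasDerivAt (fun y => -(k * (y - a))) (-k) y := by
      simpa using (((hasDerivAt_id y).sub_const a).const_mul k).fun_neg
    exact hl.exp.congr_deriv (by rw [hk]; ring)
  have hge : ∀ y ∈ Set.Icc a b, κ ≤ Real.exp (-(k * (y - a))) ∧ Real.exp (-(k * (y - a))) ≤ 1 := by
    intro y hy
    constructor
    · apply Real.exp_le_exp.2
      have := hy.2
      gcongr
    · apply Real.exp_le_one_iff.2
      have : 0 ≤ k * (y - a) := mul_nonneg hk0.le (by linarith [hy.1])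
      linarith
  have hgb : ∀ y ∈ Set.Icc a b, -1 ≤ g y ∧ g y ≤ 0 := by
    intro y hy
    have h1 := hge y hy
    have h2 : Real.exp (-(k * (y - a))) / k ≤ 1 := (div_le_one hk0).2 (h1.2.trans hk1)
    have h3 : 0 ≤ Real.exp (-(k * (y - a))) / k := by positivity
    exact ⟨by simp only [hg]; linarith, by simp only [hg]; linarith⟩
  have hfnn : ∀ x, |x - x₀| < L → 0 ≤ f x := by
    intro x hx
    have h1 := (hasDerivAt_neg_log_cos hc0 hx).2.2
    have h2 := Real.log_nonpos h1.le (Real.cos_le_one _)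
    simp only [hf]
    rw [neg_nonneg]
    exact div_nonpos_of_nonpos_of_nonneg h2 hc0.le
  have hxy : ∀ x y, |x - x₀| ≤ L → y ∈ Set.Icc a b → |τ * x * y| ≤ |τ| * (|x₀| + L) * Y := by
    intro x y hx hy
    rw [abs_mul, abs_mul]
    have : |x| ≤ |x₀| + L := by
      calc |x| = |x₀ + (x - x₀)| := by ring_nf
        _ ≤ |x₀| + |x - x₀| := abs_add_le _ _
        _ ≤ |x₀| + L := by gcongr
    have := hYb y hy
    gcongr
  set B : ℝ × ℝ → ℝ := fun q => τ * q.1 * q.2 + f q.1 + g q.2 with hB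
  -- the comparison with the barrier
  have key : u (x₀, y₀) - B (x₀, y₀) ≤ K := by
    by_contra! hcon
    -- a bound for `u` on the slab
    have hcompact : ∀ r, IsCompact (closure Ω ∩ {p : ℝ × ℝ | |p.1 - x₀| ≤ r}) := by
      intro r
      refine (isCompact_Icc.prod isCompact_Icc : IsCompact
        (Set.Icc (x₀ - r) (x₀ + r) ×ˢ Set.Icc a b)).of_isClosed_subset
        (isClosed_closure.inter (isClosed_le (by fun_prop) continuous_const)) ?_
      rintro q ⟨h1, h2⟩
      have h2' : |q.1 - x₀| ≤ r := h2
      rw [abs_le] at h2'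
      exact ⟨⟨by linarith, by linarith⟩, hcl h1⟩
    obtain ⟨U, hU⟩ := ((hcompact L).image_of_continuousOn
      (hu0.mono Set.inter_subset_left)).bddAbove
    have hU' : ∀ q ∈ closure Ω, |q.1 - x₀| ≤ L → u q ≤ U :=
      fun q h1 h2 => hU ⟨q, ⟨h1, h2⟩, rfl⟩
    set N := max (U - M) 1 with hN
    have hN1 : 1 ≤ N := le_max_right _ _
    have hexp1 : Real.exp (-(c * N)) < 1 := by
      rw [Real.exp_lt_one_iff]; nlinarith
    set L' := Real.arccos (Real.exp (-(c * N))) / c with hL'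
    have hL'L : L' < L := by
      have : Real.arccos (Real.exp (-(c * N))) < Real.pi / 2 :=
        Real.arccos_lt_pi_div_two.2 (Real.exp_pos _)
      rw [hL', hL, div_lt_div_iff₀ hc0 (by positivity)]
      nlinarith
    have hL'0 : 0 < L' := div_pos (Real.arccos_pos.2 hexp1) hc0
    have hfL' : ∀ x, |x - x₀| = L' → f x = N := by
      intro x hx
      have h1 : Real.cos (c * (x - x₀)) = Real.exp (-(c * N)) := by
        rw [← Real.cos_abs, abs_mul, abs_of_pos hc0, hx, hL', mul_div_cancel₀ _ hc0.ne',
          Real.cos_arccos (by linarith [Real.exp_pos (-(c * N))]) hexp1.le]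
      simp only [hf, h1, Real.log_exp]
      field_simp
    have hBc : ContinuousOn (fun q => u q - B q) (closure Ω ∩ {p : ℝ × ℝ | |p.1 - x₀| ≤ L'}) := by
      refine (hu0.mono Set.inter_subset_left).sub ?_
      rintro q ⟨_, hq⟩
      have h1 := (hasDerivAt_neg_log_cos hc0
        (lt_of_le_of_lt hq hL'L : |q.1 - x₀| < Real.pi / (2 * c))).1.continuousAt
      have h2 := (hg' q.2).continuousAt
      have h3 : ContinuousAt (fun q : ℝ × ℝ => f q.1) q :=
        ContinuousAt.comp (f := Prod.fst) (g := f) h1 continuousAt_fst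
      have h4 : ContinuousAt (fun q : ℝ × ℝ => g q.2) q :=
        ContinuousAt.comp (f := Prod.snd) (g := g) h2 continuousAt_snd
      have h5 : ContinuousAt (fun q : ℝ × ℝ => τ * q.1 * q.2) q := by fun_prop
      exact ((h5.add h3).add h4).continuousWithinAt
    obtain ⟨q, ⟨hq1, hq2⟩, hqmax⟩ := (hcompact L').exists_isMaxOn
      ⟨(x₀, y₀), subset_closure hp₀, by simpa using hL'0.le⟩ hBc
    have hqK : K < u q - B q := hcon.trans_le
      (hqmax (a := (x₀, y₀)) ⟨subset_closure hp₀, by simpa using hL'0.le⟩)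
    have hq2' : |q.1 - x₀| ≤ L' := hq2
    have hqy := hcl hq1
    have hqxy := (abs_le.1 (hxy q.1 q.2 (hq2'.trans hL'L.le) hqy)).1
    have hqg := (hgb q.2 hqy).1
    have hqΩ : q ∈ Ω := by
      by_contra hn
      have hfr : q ∈ frontier Ω := ⟨hq1, by rwa [hΩo.interior_eq]⟩
      have := hM q hfr
      have := hfnn q.1 (hq2'.trans_lt hL'L)
      simp only [hB] at hqK
      linarith
    have hqL : |q.1 - x₀| < L' := by
      refine lt_of_le_of_ne hq2' fun heq => ?_
      have h1 := hfL' q.1 heq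
      have h2 := hU' q hq1 (hq2'.trans hL'L.le)
      have h3 : U - M ≤ N := le_max_left _ _
      simp only [hB] at hqK
      linarith
    have hloc : IsLocalMax (fun q => u q - B q) q := by
      have hnear : Ω ∩ {p : ℝ × ℝ | |p.1 - x₀| < L'} ∈ nhds q :=
        (hΩo.inter (isOpen_lt (by fun_prop) continuous_const)).mem_nhds ⟨hqΩ, hqL⟩
      filter_upwards [hnear] with z hz
      have hz2 : |z.1 - x₀| < L' := hz.2
      exact hqmax ⟨subset_closure hz.1, hz2.le⟩
    have hqC := hu.contDiffAt (hΩo.mem_nhds hqΩ)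
    have hfn : ∀ᶠ x in nhds q.1, HasDerivAt f (Real.tan (c * (x - x₀))) x := by
      have : {x : ℝ | |x - x₀| < L} ∈ nhds q.1 :=
        (isOpen_lt (by fun_prop) continuous_const).mem_nhds (hqL.trans hL'L)
      filter_upwards [this] with x hx using (hasDerivAt_neg_log_cos hc0 hx).1
    have hjet := hasLineJet_mul_add (τ := τ) (p := q) hfn
      (hasDerivAt_neg_log_cos hc0 (hqL.trans hL'L)).2.1 (Filter.Eventually.of_forall hg') (hg'' q.2)
    obtain ⟨h1, h2, h3⟩ := nil_touching humin hqΩ hqC hjet hloc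
    have hα : nilAlpha τ u q = Real.tan (c * (q.1 - x₀)) + 2 * τ * q.2 := by
      rw [nilAlpha, h1]; ring
    have hβ : nilBeta τ u q = Real.exp (-(k * (q.2 - a))) := by
      rw [nilBeta, h2]; ring
    rw [hα, hβ] at h3
    have hlt := barrier_neg (τ := τ) (T := T) (t := 2 * τ * q.2)
      (f₁ := Real.tan (c * (q.1 - x₀))) (hge q.2 hqy).1 (hge q.2 hqy).2 hκ0
      (by rw [abs_mul, abs_mul, hT, abs_two]; have := hYb q.2 hqy; gcongr) hc rfl
    linarith
  have hy₀ := hcl (subset_closure hp₀)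
  have hBp : B (x₀, y₀) ≤ |τ| * |x₀| * Y := by
    have h1 : τ * x₀ * y₀ ≤ |τ| * |x₀| * Y := by
      refine (le_abs_self _).trans ?_
      rw [abs_mul, abs_mul]
      have := hYb y₀ hy₀
      gcongr
    have h2 := (hgb y₀ hy₀).2
    simp only [hB, hf, sub_self, mul_zero, Real.cos_zero, Real.log_one, zero_div, neg_zero, add_zero]
    linarith
  have hC1 := le_max_left (|τ| * L * Y + 1) (2 * Y)
  have hC2 := le_max_right (|τ| * L * Y + 1) (2 * Y)
  have hC3 := mul_le_mul_of_nonneg_right hC2 (by positivity : 0 ≤ |τ| * |x₀|)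
  simp only
  nlinarith

lemma hasLineJet_quadratic (ε k : ℝ) (e c p : ℝ × ℝ) :
    HasLineJet (fun q => -ε * ((q.1 - c.1) * e.1 + (q.2 - c.2) * e.2 +
        k * ((q.1 - c.1) * e.1 + (q.2 - c.2) * e.2) ^ 2 - (q.1 - c.1) ^ 2 - (q.2 - c.2) ^ 2)) p
      (-ε * (e.1 + 2 * k * ((p.1 - c.1) * e.1 + (p.2 - c.2) * e.2) * e.1 - 2 * (p.1 - c.1)))
      (-ε * (e.2 + 2 * k * ((p.1 - c.1) * e.1 + (p.2 - c.2) * e.2) * e.2 - 2 * (p.2 - c.2)))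
      (-ε * (2 * k * e.1 ^ 2 - 2)) (-ε * (2 * k * e.1 * e.2)) (-ε * (2 * k * e.2 ^ 2 - 2)) := by
  intro d
  have hx : ∀ t : ℝ, HasDerivAt (fun t : ℝ => p.1 + t * d.1 - c.1) d.1 t := fun t => by
    simpa using (((hasDerivAt_id t).mul_const d.1).const_add p.1).sub_const c.1
  have hy : ∀ t : ℝ, HasDerivAt (fun t : ℝ => p.2 + t * d.2 - c.2) d.2 t := fun t => by
    simpa using (((hasDerivAt_id t).mul_const d.2).const_add p.2).sub_const c.2
  have hl : ∀ t : ℝ, HasDerivAt (fun t : ℝ => (p.1 + t * d.1 - c.1) * e.1 +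
      (p.2 + t * d.2 - c.2) * e.2) (d.1 * e.1 + d.2 * e.2) t := fun t =>
    ((hx t).mul_const e.1).fun_add ((hy t).mul_const e.2)
  refine ⟨fun t => -ε * (d.1 * e.1 + d.2 * e.2 + 2 * k * ((p.1 + t * d.1 - c.1) * e.1 +
      (p.2 + t * d.2 - c.2) * e.2) * (d.1 * e.1 + d.2 * e.2) -
      2 * (p.1 + t * d.1 - c.1) * d.1 - 2 * (p.2 + t * d.2 - c.2) * d.2), ?_, ?_, ?_⟩
  · refine Filter.Eventually.of_forall fun t => ?_
    have := (((((hl t).add (((hl t).pow 2).const_mul k)).sub ((hx t).pow 2)).sub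
      ((hy t).pow 2)).const_mul (-ε))
    refine (this.congr_deriv ?_).congr_of_eventuallyEq (Filter.Eventually.of_forall ?_)
    · push_cast; ring
    · intro s; simp
  · simp only [zero_mul, add_zero]; ring
  · have := (((((((hl 0).const_mul (2 * k)).mul_const (d.1 * e.1 + d.2 * e.2)).const_add
      (d.1 * e.1 + d.2 * e.2)).sub (((hx 0).const_mul 2).mul_const d.1)).sub
      (((hy 0).const_mul 2).mul_const d.2)).const_mul (-ε))
    exact this.congr_deriv (by ring)

/-- Hopf-type lemma: an interior maximum is not touched by a ball on which the function is
smaller. -/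
lemma nil_not_touching_ball {τ M : ℝ} {Ω : Set (ℝ × ℝ)} (hΩo : IsOpen Ω) {u : ℝ × ℝ → ℝ}
    (hu : ContDiffOn ℝ 2 u Ω) (humin : NilMinimal τ u Ω) (hle : ∀ p ∈ Ω, u p ≤ M)
    {c e : ℝ × ℝ} (hc : c ∈ Ω) (huc : u c = M) (he : 0 < e.1 ^ 2 + e.2 ^ 2)
    (hlt : ∀ᶠ q in nhds c, (q.1 - c.1) ^ 2 + (q.2 - c.2) ^ 2 <
      2 * ((q.1 - c.1) * e.1 + (q.2 - c.2) * e.2) → u q < M) : False := by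
  have hcC := hu.contDiffAt (hΩo.mem_nhds hc)
  obtain ⟨k, hk0, hk⟩ : ∃ k : ℝ, 0 < k ∧ 2 + nilAlpha τ u c ^ 2 + nilBeta τ u c ^ 2 <
      k * (e.1 ^ 2 + e.2 ^ 2) := by
    refine ⟨(3 + nilAlpha τ u c ^ 2 + nilBeta τ u c ^ 2) / (e.1 ^ 2 + e.2 ^ 2), by positivity, ?_⟩
    rw [div_mul_cancel₀ _ he.ne']
    linarith
  have hcoef : ∀ᶠ q in nhds c, 2 + nilAlpha τ u q ^ 2 + nilBeta τ u q ^ 2 <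
      k * (e.1 ^ 2 + e.2 ^ 2) := by
    have h1 := (contDiffAt_nilAlpha (τ := τ) hcC).continuousAt
    have h2 := (contDiffAt_nilBeta (τ := τ) hcC).continuousAt
    exact ((continuousAt_const.add (h1.pow 2)).add (h2.pow 2)).eventually_lt continuousAt_const hk
  have hsmall : ∀ᶠ q in nhds c, k * |(q.1 - c.1) * e.1 + (q.2 - c.2) * e.2| < 1 := by
    have : ContinuousAt (fun q : ℝ × ℝ => k * |(q.1 - c.1) * e.1 + (q.2 - c.2) * e.2|) c := by
      fun_prop
    exact this.eventually_lt continuousAt_const (by simp)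
  obtain ⟨ρ, hρ, hball⟩ := Metric.nhds_basis_closedBall.eventually_iff.1
    (((hΩo.eventually_mem hc).and hcoef).and (hsmall.and hlt))
  set h : ℝ × ℝ → ℝ := fun q => (q.1 - c.1) * e.1 + (q.2 - c.2) * e.2 +
    k * ((q.1 - c.1) * e.1 + (q.2 - c.2) * e.2) ^ 2 - (q.1 - c.1) ^ 2 - (q.2 - c.2) ^ 2 with hh
  have hhc : Continuous h := by fun_prop
  have huB : ContinuousOn u (Metric.closedBall c ρ) :=
    hu.continuousOn.mono fun q hq => (hball hq).1.1
  have hneg : ∀ q ∈ Metric.sphere c ρ, 0 ≤ h q → u q < M := by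
    intro q hq hq0
    have hb := hball (Metric.sphere_subset_closedBall hq)
    refine hb.2.2 ?_
    have h1 := hb.2.1
    simp only [hh] at hq0
    set t := (q.1 - c.1) * e.1 + (q.2 - c.2) * e.2 with ht
    have h3 : 0 < (q.1 - c.1) ^ 2 + (q.2 - c.2) ^ 2 := by
      by_contra! h4
      have h5 : q.1 - c.1 = 0 := by nlinarith [sq_nonneg (q.1 - c.1), sq_nonneg (q.2 - c.2)]
      have h6 : q.2 - c.2 = 0 := by nlinarith [sq_nonneg (q.1 - c.1), sq_nonneg (q.2 - c.2)]
      have : q = c := Prod.ext (by linarith) (by linarith)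
      rw [Metric.mem_sphere, this, dist_self] at hq
      exact hρ.ne hq
    have h7 : k * t ≤ k * |t| := by gcongr; exact le_abs_self t
    have h8 : -(k * t) ≤ k * |t| := by rw [← mul_neg]; gcongr; exact neg_le_abs t
    have ht0 : 0 < t := by
      by_contra! h4
      nlinarith
    nlinarith
  obtain ⟨ε, hε, hS⟩ : ∃ ε : ℝ, 0 < ε ∧ ∀ q ∈ Metric.sphere c ρ, u q + ε * h q < M := by
    set S := Metric.sphere c ρ ∩ {q | 0 ≤ h q} with hSdef
    have hScomp : IsCompact S :=
      (isCompact_sphere c ρ).inter_right (isClosed_le continuous_const hhc)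
    rcases S.eq_empty_or_nonempty with hemp | hne
    · refine ⟨1, one_pos, fun q hq => ?_⟩
      have h1 : h q < 0 := by
        by_contra! h2
        have : q ∈ S := ⟨hq, h2⟩
        rw [hemp] at this
        exact this
      have := hle q (hball (Metric.sphere_subset_closedBall hq)).1.1
      linarith
    · obtain ⟨q₁, hq₁, hmax⟩ := hScomp.exists_isMaxOn hne
        (huB.mono (Set.inter_subset_left.trans Metric.sphere_subset_closedBall))
      obtain ⟨q₂, hq₂, hmax₂⟩ := hScomp.exists_isMaxOn hne hhc.continuousOn
      have h1 := hneg q₁ hq₁.1 hq₁.2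
      have h2 : 0 ≤ h q₂ := hq₂.2
      have h3 : 0 < (M - u q₁) / (h q₂ + 1) := div_pos (by linarith) (by linarith)
      refine ⟨_, h3, fun q hq => ?_⟩
      by_cases hq0 : 0 ≤ h q
      · have h4 : u q ≤ u q₁ := hmax ⟨hq, hq0⟩
        have h5 : h q ≤ h q₂ := hmax₂ ⟨hq, hq0⟩
        have h6 : (M - u q₁) / (h q₂ + 1) * h q < (M - u q₁) / (h q₂ + 1) * (h q₂ + 1) := by
          gcongr; linarith
        rw [div_mul_cancel₀ _ (by linarith)] at h6
        linarith
      · have h4 := hle q (hball (Metric.sphere_subset_closedBall hq)).1.1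
        have := mul_neg_of_pos_of_neg h3 (not_le.1 hq0)
        linarith
  obtain ⟨q, hq, hmax⟩ := (isCompact_closedBall c ρ).exists_isMaxOn ⟨c, by simp [hρ.le]⟩
    (f := fun q => u q - -ε * h q) (huB.sub (by fun_prop))
  have hqM : M ≤ u q - -ε * h q := by
    have := hmax (a := c) (by simp [hρ.le])
    simpa [hh, huc] using this
  have hqb : q ∈ Metric.ball c ρ := by
    refine Metric.mem_ball.2 (lt_of_le_of_ne (Metric.mem_closedBall.1 hq) fun heq => ?_)
    have := hS q heq
    linarith
  have hloc : IsLocalMax (fun q => u q - -ε * h q) q := by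
    filter_upwards [Metric.isOpen_ball.mem_nhds hqb] with z hz
    exact hmax (Metric.ball_subset_closedBall hz)
  have hb := (hball hq).1
  obtain ⟨-, -, h3⟩ := nil_touching humin hb.1 (hu.contDiffAt (hΩo.mem_nhds hb.1))
    (hasLineJet_quadratic ε k e c q) hloc
  have h4 := hb.2
  have h5 : 0 ≤ k * (nilBeta τ u q * e.1 - nilAlpha τ u q * e.2) ^ 2 := by positivity
  have h6 : 0 < ε * (k * (e.1 ^ 2 + e.2 ^ 2) +
      k * (nilBeta τ u q * e.1 - nilAlpha τ u q * e.2) ^ 2 -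
      (2 + nilAlpha τ u q ^ 2 + nilBeta τ u q ^ 2)) := mul_pos hε (by linarith)
  nlinarith

lemma nil_strong_maximum {τ M : ℝ} {Ω : Set (ℝ × ℝ)} (hΩo : IsOpen Ω) (hΩc : IsPreconnected Ω)
    {u : ℝ × ℝ → ℝ} (hu : ContDiffOn ℝ 2 u Ω) (humin : NilMinimal τ u Ω)
    (hle : ∀ p ∈ Ω, u p ≤ M) {p₀ : ℝ × ℝ} (hp₀ : p₀ ∈ Ω) (hup₀ : u p₀ = M) :
    ∀ p ∈ Ω, u p = M := by
  have hE : IsOpen {p | p ∈ Ω ∧ u p = M} := by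
    rw [isOpen_iff_mem_nhds]
    rintro p ⟨hp, hup⟩
    obtain ⟨ρ, hρ, hball⟩ := Metric.nhds_basis_closedBall.mem_iff.1 (hΩo.mem_nhds hp)
    refine Filter.mem_of_superset (Metric.ball_mem_nhds p (by positivity : 0 < ρ / 4)) ?_
    intro q hq
    have hqd : dist q p < ρ / 4 := hq
    have hqΩ : q ∈ Ω := hball (Metric.mem_closedBall.2 (by linarith))
    refine ⟨hqΩ, ?_⟩
    by_contra hne
    have hcoord : ∀ z w : ℝ × ℝ, ∀ r, dist z w < r ↔ |z.1 - w.1| < r ∧ |z.2 - w.2| < r := by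
      intro z w r
      rw [Prod.dist_eq, max_lt_iff, Real.dist_eq, Real.dist_eq]
    set K := Metric.closedBall p ρ ∩ u ⁻¹' {M} with hK
    have hKc : IsCompact K := (isCompact_closedBall p ρ).of_isClosed_subset
      ((hu.continuousOn.mono hball).preimage_isClosed_of_isClosed Metric.isClosed_closedBall
        isClosed_singleton) Set.inter_subset_left
    obtain ⟨c, hcK, hcmin⟩ := hKc.exists_isMinOn ⟨p, by simp [hρ.le], hup⟩
      (f := fun z : ℝ × ℝ => (z.1 - q.1) ^ 2 + (z.2 - q.2) ^ 2) (by fun_prop)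
    have hcp : (c.1 - q.1) ^ 2 + (c.2 - q.2) ^ 2 ≤ (p.1 - q.1) ^ 2 + (p.2 - q.2) ^ 2 :=
      hcmin (a := p) ⟨by simp [hρ.le], hup⟩
    have hqp := (hcoord q p _).1 hqd
    have h1 : (p.1 - q.1) ^ 2 < (ρ / 4) ^ 2 := by
      rw [← sq_abs, abs_sub_comm]; gcongr; exact hqp.1
    have h2 : (p.2 - q.2) ^ 2 < (ρ / 4) ^ 2 := by
      rw [← sq_abs, abs_sub_comm]; gcongr; exact hqp.2
    have h3 : dist c q < ρ / 2 := (hcoord c q _).2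
      ⟨abs_lt_of_sq_lt_sq (by nlinarith [sq_nonneg (c.2 - q.2)]) (by positivity),
        abs_lt_of_sq_lt_sq (by nlinarith [sq_nonneg (c.1 - q.1)]) (by positivity)⟩
    have h4 : dist c p < ρ := by linarith [dist_triangle c q p]
    refine nil_not_touching_ball hΩo hu humin hle (hball hcK.1) hcK.2 (e := q - c) ?_ ?_
    · by_contra! h5
      simp only [Prod.fst_sub, Prod.snd_sub] at h5
      have h6 : q.1 - c.1 = 0 := by nlinarith [sq_nonneg (q.1 - c.1), sq_nonneg (q.2 - c.2)]
      have h7 : q.2 - c.2 = 0 := by nlinarith [sq_nonneg (q.1 - c.1), sq_nonneg (q.2 - c.2)]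
      have : q = c := Prod.ext (by linarith) (by linarith)
      exact hne (this ▸ hcK.2)
    · filter_upwards [Metric.isOpen_ball.mem_nhds (show c ∈ Metric.ball p ρ from h4)] with z hz hlt
      refine lt_of_le_of_ne (hle z (hball (Metric.ball_subset_closedBall hz))) fun heq => ?_
      have h5 : (c.1 - q.1) ^ 2 + (c.2 - q.2) ^ 2 ≤ (z.1 - q.1) ^ 2 + (z.2 - q.2) ^ 2 :=
        hcmin (a := z) ⟨Metric.ball_subset_closedBall hz, heq⟩
      simp only [Prod.fst_sub, Prod.snd_sub] at hlt
      nlinarith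
  have hA : IsOpen (Ω ∩ u ⁻¹' {x | x ≠ M}) :=
    hu.continuousOn.isOpen_inter_preimage hΩo isOpen_ne
  by_contra! hcon
  obtain ⟨q, hq, hqM⟩ := hcon
  obtain ⟨z, -, hz1, hz2⟩ := hΩc _ _ hE hA (fun z hz => by
    by_cases h : u z = M
    · exact Or.inl ⟨hz, h⟩
    · exact Or.inr ⟨hz, h⟩) ⟨p₀, hp₀, hp₀, hup₀⟩ ⟨q, hq, hq, hqM⟩
  exact hz2.2 hz1.2

lemma hasDerivAt_posPart_sq (t : ℝ) : HasDerivAt (fun t : ℝ => max t 0 ^ 2) (2 * max t 0) t := by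
  rcases lt_trichotomy t 0 with h | rfl | h
  · rw [max_eq_right h.le, mul_zero]
    refine (hasDerivAt_const t (0 : ℝ)).congr_of_eventuallyEq ?_
    filter_upwards [gt_mem_nhds h] with s hs
    simp [max_eq_right (le_of_lt hs)]
  · rw [hasDerivAt_iff_isLittleO]
    have h1 : (fun x : ℝ => x ^ 2) =o[nhds 0] fun x : ℝ => x := by
      simpa using Asymptotics.isLittleO_pow_id (𝕜 := ℝ) (n := 2) (by norm_num)
    have h2 : (fun x : ℝ => max x 0 ^ 2) =O[nhds 0] fun x : ℝ => x ^ 2 := by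
      refine Asymptotics.isBigO_of_le _ fun x => ?_
      rcases le_total x 0 with h | h
      · simpa [max_eq_right h] using sq_nonneg x
      · simp [max_eq_left h]
    simpa using h2.trans_isLittleO h1
  · rw [max_eq_left h.le]
    have := hasDerivAt_pow 2 t
    simp only [Nat.cast_ofNat, Nat.add_one_sub_one, pow_one] at this
    refine this.congr_of_eventuallyEq ?_
    filter_upwards [lt_mem_nhds h] with s hs
    simp [max_eq_left (le_of_lt hs)]

lemma contDiff_posPart_sq : ContDiff ℝ 1 (fun t : ℝ => max t 0 ^ 2) := by
  rw [contDiff_one_iff_deriv]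
  refine ⟨fun t => (hasDerivAt_posPart_sq t).differentiableAt, ?_⟩
  rw [funext fun t => (hasDerivAt_posPart_sq t).deriv]
  fun_prop

/-- A `C¹` convex function with slope at most one, vanishing exactly on `(-∞, 0]`. -/
def softPos (t : ℝ) : ℝ := √(1 + max t 0 ^ 2) - 1

/-- The derivative of `softPos`. -/
def softPosDeriv (t : ℝ) : ℝ := max t 0 / √(1 + max t 0 ^ 2)

lemma hasDerivAt_softPos (t : ℝ) : HasDerivAt softPos (softPosDeriv t) t := by
  have := (((hasDerivAt_posPart_sq t).const_add 1).sqrt (by positivity)).sub_const 1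
  refine this.congr_deriv ?_
  rw [softPosDeriv]
  field_simp

lemma contDiff_softPos : ContDiff ℝ 1 softPos :=
  ((contDiff_const.add contDiff_posPart_sq).sqrt fun t => by positivity).sub contDiff_const

lemma continuous_softPosDeriv : Continuous softPosDeriv := by
  unfold softPosDeriv
  exact Continuous.div (by fun_prop) (by fun_prop) fun t => by positivity

lemma softPosDeriv_nonneg (t : ℝ) : 0 ≤ softPosDeriv t := by unfold softPosDeriv; positivity

lemma softPosDeriv_pos {t : ℝ} (ht : 0 < t) : 0 < softPosDeriv t := by
  unfold softPosDeriv
  have : 0 < max t 0 := lt_max_of_lt_left ht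
  positivity

lemma softPosDeriv_le_one (t : ℝ) : softPosDeriv t ≤ 1 := by
  unfold softPosDeriv
  rw [div_le_one (by positivity)]
  exact Real.le_sqrt_of_sq_le (by linarith)

lemma softPos_nonneg (t : ℝ) : 0 ≤ softPos t := by
  unfold softPos
  have : 1 ≤ √(1 + max t 0 ^ 2) := Real.one_le_sqrt.2 (by nlinarith [sq_nonneg (max t 0)])
  linarith

lemma softPos_of_nonpos {t : ℝ} (ht : t ≤ 0) : softPos t = 0 := by
  simp [softPos, max_eq_right ht]

lemma softPos_le (t : ℝ) : softPos t ≤ max t 0 * softPosDeriv t := by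
  unfold softPos softPosDeriv
  have h1 : 0 < √(1 + max t 0 ^ 2) := by positivity
  have h2 := Real.sq_sqrt (show 0 ≤ 1 + max t 0 ^ 2 by positivity)
  have h3 : 1 ≤ √(1 + max t 0 ^ 2) := Real.one_le_sqrt.2 (by nlinarith [sq_nonneg (max t 0)])
  rw [← mul_div_assoc, le_div_iff₀ h1]
  nlinarith

/-- Monotonicity of the minimal graph operator, in terms of the generalised gradients. -/
lemma nil_monotone {a₁ b₁ a₂ b₂ W₁ W₂ : ℝ} (h₁ : 0 < W₁) (h₂ : 0 < W₂)
    (e₁ : W₁ ^ 2 = 1 + a₁ ^ 2 + b₁ ^ 2) (e₂ : W₂ ^ 2 = 1 + a₂ ^ 2 + b₂ ^ 2) :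
    (a₁ - a₂) * (a₁ / W₁ - a₂ / W₂) + (b₁ - b₂) * (b₁ / W₁ - b₂ / W₂) =
      (W₁ + W₂) / 2 * ((a₁ / W₁ - a₂ / W₂) ^ 2 + (b₁ / W₁ - b₂ / W₂) ^ 2 +
        (1 / W₁ - 1 / W₂) ^ 2) := by
  field_simp
  have ha : a₁ ^ 2 = W₁ ^ 2 - 1 - b₁ ^ 2 := by linarith
  have hb : a₂ ^ 2 = W₂ ^ 2 - 1 - b₂ ^ 2 := by linarith
  ring_nf
  grind

lemma contDiff_indicator_of_eventually_eq_zero {Ω : Set (ℝ × ℝ)} (hΩo : IsOpen Ω)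
    {F : ℝ × ℝ → ℝ} (hF : ∀ p ∈ Ω, ContDiffAt ℝ 1 F p)
    (h0 : ∀ p ∈ frontier Ω, ∀ᶠ q in nhds p, q ∈ Ω → F q = 0) :
    ContDiff ℝ 1 (Ω.indicator F) ∧ (∀ p ∈ Ω, fderiv ℝ (Ω.indicator F) p = fderiv ℝ F p) ∧
      ∀ p ∉ Ω, fderiv ℝ (Ω.indicator F) p = 0 := by
  have hin : ∀ p ∈ Ω, Ω.indicator F =ᶠ[nhds p] F := fun p hp => by
    filter_upwards [hΩo.mem_nhds hp] with q hq using Set.indicator_of_mem hq F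
  have hout : ∀ p ∉ Ω, Ω.indicator F =ᶠ[nhds p] fun _ => 0 := by
    intro p hp
    by_cases hc : p ∈ closure Ω
    · filter_upwards [h0 p ⟨hc, by rwa [hΩo.interior_eq]⟩] with q hq
      by_cases hqΩ : q ∈ Ω
      · rw [Set.indicator_of_mem hqΩ, hq hqΩ]
      · exact Set.indicator_of_notMem hqΩ F
    · filter_upwards [isClosed_closure.isOpen_compl.mem_nhds hc] with q hq
      exact Set.indicator_of_notMem (fun h => hq (subset_closure h)) F
  refine ⟨contDiff_iff_contDiffAt.2 fun p => ?_, fun p hp => (hin p hp).fderiv_eq, fun p hp => ?_⟩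
  · by_cases hp : p ∈ Ω
    · exact (hF p hp).congr_of_eventuallyEq (hin p hp)
    · exact contDiffAt_const.congr_of_eventuallyEq (hout p hp)
  · rw [(hout p hp).fderiv_eq, fderiv_fun_const]
    rfl

lemma arsinh_le_log {R : ℝ} (hR : 2 ≤ R) : Real.arsinh R ≤ Real.log (1 + R ^ 2) := by
  rw [Real.arsinh]
  refine Real.log_le_log (by positivity) ?_
  have : √(1 + R ^ 2) ≤ 1 + R ^ 2 - R := by
    refine Real.sqrt_le_iff.2 ⟨by nlinarith, ?_⟩
    have h1 : 1 ≤ (R - 1) ^ 2 := by nlinarith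
    nlinarith [mul_le_mul_of_nonneg_left h1 (by positivity : 0 ≤ 1 + R ^ 2), sq_nonneg R]
  linarith

/-- If the divergence of a `C¹` field vanishing at the boundary of a box is bounded below by
`D - K / √(1 + x²)`, then the integral of `D` over any measurable subset of the box is controlled. -/
lemma measure_le_of_divergence {Z₁ Z₂ D : ℝ × ℝ → ℝ} {a b R K δ : ℝ} (hab : a ≤ b) (hR : 0 ≤ R)
    (h₁ : ContDiff ℝ 1 Z₁) (h₂ : ContDiff ℝ 1 Z₂)
    (hx₁ : ∀ y, Z₁ (R, y) = 0) (hx₂ : ∀ y, Z₁ (-R, y) = 0)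
    (hy₁ : ∀ x, Z₂ (x, a) = 0) (hy₂ : ∀ x, Z₂ (x, b) = 0)
    (hD : ∀ p, D p ≤ fderiv ℝ Z₁ p (1, 0) + fderiv ℝ Z₂ p (0, 1) + K * (√(1 + p.1 ^ 2))⁻¹)
    (hD0 : ∀ p, 0 ≤ D p) {S : Set (ℝ × ℝ)} (hS : MeasurableSet S)
    (hSbox : S ⊆ Set.Icc (-R, a) (R, b)) (hSδ : ∀ p ∈ S, δ ≤ D p) :
    δ * MeasureTheory.volume.real S ≤ 2 * K * (b - a) * Real.arsinh R := by
  have hA : ∀ p : ℝ × ℝ, HasFDerivAt (fun p : ℝ × ℝ => Z₁ p + K * Real.arsinh p.1)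
      (fderiv ℝ Z₁ p + K • (√(1 + p.1 ^ 2))⁻¹ • ContinuousLinearMap.fst ℝ ℝ ℝ) p := fun p =>
    ((h₁.differentiable (by norm_num)) p).hasFDerivAt.add
      (((Real.hasDerivAt_arsinh p.1).comp_hasFDerivAt p hasFDerivAt_fst).const_mul K)
  have hcont : Continuous (fun p : ℝ × ℝ =>
      (fderiv ℝ Z₁ p + K • (√(1 + p.1 ^ 2))⁻¹ • ContinuousLinearMap.fst ℝ ℝ ℝ) (1, 0) +
        fderiv ℝ Z₂ p (0, 1)) := by
    have c1 := h₁.continuous_fderiv (by norm_num)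
    have c2 := h₂.continuous_fderiv (by norm_num)
    have c3 : Continuous fun p : ℝ × ℝ => (√(1 + p.1 ^ 2))⁻¹ :=
      Continuous.inv₀ (by fun_prop) fun p => by positivity
    fun_prop
  have hint : MeasureTheory.IntegrableOn (fun p : ℝ × ℝ =>
      (fderiv ℝ Z₁ p + K • (√(1 + p.1 ^ 2))⁻¹ • ContinuousLinearMap.fst ℝ ℝ ℝ) (1, 0) +
        fderiv ℝ Z₂ p (0, 1)) (Set.Icc (-R, a) (R, b)) MeasureTheory.volume :=
    hcont.continuousOn.integrableOn_compact isCompact_Icc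
  have hdiv := MeasureTheory.integral_divergence_prod_Icc_of_hasFDerivAt_off_countable_of_le
    (fun p : ℝ × ℝ => Z₁ p + K * Real.arsinh p.1) Z₂ _ (fderiv ℝ Z₂) (-R, a) (R, b)
    ⟨by simp only; linarith, hab⟩ ∅ Set.countable_empty
    (fun p _ => (hA p).continuousAt.continuousWithinAt) h₂.continuous.continuousOn
    (fun p _ => hA p) (fun p _ => ((h₂.differentiable (by norm_num)) p).hasFDerivAt) hint
  simp only [hx₁, hx₂, hy₁, hy₂, intervalIntegral.integral_const, smul_eq_mul, zero_add,
    Real.arsinh_neg] at hdiv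
  have hlow : ∀ p, D p ≤
      (fderiv ℝ Z₁ p + K • (√(1 + p.1 ^ 2))⁻¹ • ContinuousLinearMap.fst ℝ ℝ ℝ) (1, 0) +
        fderiv ℝ Z₂ p (0, 1) := by
    intro p
    refine (hD p).trans (le_of_eq ?_)
    simp only [add_apply, smul_apply, ContinuousLinearMap.coe_fst', smul_eq_mul]
    ring
  have hSfin : MeasureTheory.volume S ≠ ⊤ :=
    ((MeasureTheory.measure_mono hSbox).trans_lt isCompact_Icc.measure_lt_top).ne
  have h3 := MeasureTheory.setIntegral_mono_set hint
    (Filter.Eventually.of_forall fun p => (hD0 p).trans (hlow p)) hSbox.eventuallyLE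
  have h4 := MeasureTheory.setIntegral_ge_of_const_le_real hS hSfin
    (fun p hp => (hSδ p hp).trans (hlow p)) (hint.mono_set hSbox)
  linarith

lemma hasDerivAt_logCutoff (Λ x : ℝ) :
    HasDerivAt (fun x => max (1 - Real.log (1 + x ^ 2) / Λ) 0 ^ 2)
      (2 * max (1 - Real.log (1 + x ^ 2) / Λ) 0 * -(2 * x / (1 + x ^ 2) / Λ)) x := by
  have h1 : HasDerivAt (fun x : ℝ => 1 + x ^ 2) (2 * x) x := by
    simpa using (hasDerivAt_pow 2 x).const_add 1
  have h2 := ((h1.log (by positivity)).div_const Λ).const_sub 1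
  exact (hasDerivAt_posPart_sq _).comp x h2

lemma contDiff_logCutoff (Λ : ℝ) :
    ContDiff ℝ 1 (fun x : ℝ => max (1 - Real.log (1 + x ^ 2) / Λ) 0 ^ 2) := by
  refine contDiff_posPart_sq.comp (g := fun t : ℝ => max t 0 ^ 2)
    (f := fun x : ℝ => 1 - Real.log (1 + x ^ 2) / Λ) ?_
  refine contDiff_const.sub (ContDiff.div_const (ContDiff.log (by fun_prop) fun x => ?_) Λ)
  positivity

lemma energy_absorb {ψ ψ' s ζ W Y₁ Y₂ E x Λ C : ℝ} (hψ : 0 ≤ ψ) (hψs : ψ ≤ s * ψ')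
    (hψ'0 : 0 ≤ ψ') (hψ'1 : ψ' ≤ 1) (hζ : 0 ≤ ζ) (hW : 0 < W) (hC : 0 ≤ C)
    (hs : s ^ 2 ≤ C * (1 + |x|) * W) (hE : W / 2 * (Y₁ ^ 2 + Y₂ ^ 2) ≤ E) :
    1 / 2 * (ζ ^ 2 * ψ' * E) ≤ ζ ^ 2 * ψ' * E + ψ * (2 * ζ * -(2 * x / (1 + x ^ 2) / Λ)) * Y₁ +
      32 * C / Λ ^ 2 * (√(1 + x ^ 2))⁻¹ := by
  set g := 2 * x / (1 + x ^ 2) / Λ with hg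
  have h1 : ψ * (2 * ζ * g) * Y₁ ≤ s * ψ' * (2 * ζ * |g|) * |Y₁| := by
    calc ψ * (2 * ζ * g) * Y₁ ≤ |ψ * (2 * ζ * g) * Y₁| := le_abs_self _
      _ = ψ * (2 * ζ * |g|) * |Y₁| := by
        rw [abs_mul, abs_mul, abs_mul, abs_mul, abs_of_nonneg hψ, abs_of_nonneg hζ, abs_two]
      _ ≤ s * ψ' * (2 * ζ * |g|) * |Y₁| := by gcongr
  have h2 : 2 * (ζ * |Y₁|) * (s * |g|) ≤ W / 4 * (ζ * |Y₁|) ^ 2 + 4 / W * (s * |g|) ^ 2 := by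
    have : W / 4 * (ζ * |Y₁|) ^ 2 + 4 / W * (s * |g|) ^ 2 - 2 * (ζ * |Y₁|) * (s * |g|) =
        W / 4 * (ζ * |Y₁| - 4 / W * (s * |g|)) ^ 2 := by
      field_simp; ring
    have h3 : 0 ≤ W / 4 * (ζ * |Y₁| - 4 / W * (s * |g|)) ^ 2 := by positivity
    linarith
  have h4 : 4 / W * (s * |g|) ^ 2 ≤ 4 * C * (1 + |x|) * g ^ 2 := by
    rw [mul_pow, sq_abs]
    calc 4 / W * (s ^ 2 * g ^ 2) ≤ 4 / W * (C * (1 + |x|) * W * g ^ 2) := by gcongr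
      _ = _ := by field_simp
  have h5 : 4 * C * (1 + |x|) * g ^ 2 ≤ 32 * C / Λ ^ 2 * (√(1 + x ^ 2))⁻¹ := by
    set q := √(1 + x ^ 2) with hq
    have hq2 : q ^ 2 = 1 + x ^ 2 := Real.sq_sqrt (by positivity)
    have hq1 : 1 ≤ q := Real.one_le_sqrt.2 (by nlinarith [sq_nonneg x])
    have hqx : |x| ≤ q := Real.abs_le_sqrt (by linarith)
    have e1 : 4 * C * (1 + |x|) * g ^ 2 = 16 * C / Λ ^ 2 * ((1 + |x|) * x ^ 2 / q ^ 4) := by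
      rw [hg, ← hq2]
      ring
    have e2 : (1 + |x|) * x ^ 2 / q ^ 4 ≤ 2 * q⁻¹ := by
      have hx1 : 1 + |x| ≤ 2 * q := by linarith
      have hx2 : x ^ 2 ≤ q ^ 2 := by linarith
      calc (1 + |x|) * x ^ 2 / q ^ 4 ≤ (2 * q) * q ^ 2 / q ^ 4 :=
            div_le_div_of_nonneg_right (mul_le_mul hx1 hx2 (sq_nonneg x) (by positivity))
              (by positivity)
        _ = 2 * q⁻¹ := by field_simp
    calc _ = _ := e1
      _ ≤ 16 * C / Λ ^ 2 * (2 * q⁻¹) := by gcongr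
      _ = _ := by ring
  have h6 : ζ ^ 2 * (W / 2 * Y₁ ^ 2) ≤ ζ ^ 2 * E := by
    gcongr
    nlinarith [sq_nonneg Y₂]
  have h7 : W / 4 * (ζ * |Y₁|) ^ 2 ≤ 1 / 2 * (ζ ^ 2 * E) := by
    rw [mul_pow, sq_abs]; linarith
  have h8 : ψ' * (2 * (ζ * |Y₁|) * (s * |g|)) ≤
      ψ' * (1 / 2 * (ζ ^ 2 * E) + 4 * C * (1 + |x|) * g ^ 2) := by
    gcongr; linarith
  have h9 : ψ' * (4 * C * (1 + |x|) * g ^ 2) ≤ 4 * C * (1 + |x|) * g ^ 2 :=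
    mul_le_of_le_one_left (by positivity) hψ'1
  nlinarith

/-- The monotonicity integrand `⟨∇(u - v), X_u - X_v⟩`. -/
def nilEnergy (τ : ℝ) (u v : ℝ × ℝ → ℝ) (p : ℝ × ℝ) : ℝ :=
  (nilAlpha τ u p - nilAlpha τ v p) *
      (nilAlpha τ u p / nilW τ u p - nilAlpha τ v p / nilW τ v p) +
    (nilBeta τ u p - nilBeta τ v p) *
      (nilBeta τ u p / nilW τ u p - nilBeta τ v p / nilW τ v p)

lemma nilEnergy_ge (τ : ℝ) (u v : ℝ × ℝ → ℝ) (p : ℝ × ℝ) :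
    nilW τ v p / 2 * ((nilAlpha τ u p / nilW τ u p - nilAlpha τ v p / nilW τ v p) ^ 2 +
      (nilBeta τ u p / nilW τ u p - nilBeta τ v p / nilW τ v p) ^ 2) ≤ nilEnergy τ u v p := by
  have h₁ := nilW_pos τ u p
  have h₂ := nilW_pos τ v p
  rw [nilEnergy, nil_monotone h₁ h₂ (nilW_sq τ u p) (nilW_sq τ v p)]
  exact mul_le_mul (by linarith) (le_add_of_nonneg_right (sq_nonneg _)) (by positivity)
    (by positivity)

lemma nilEnergy_nonneg (τ : ℝ) (u v : ℝ × ℝ → ℝ) (p : ℝ × ℝ) : 0 ≤ nilEnergy τ u v p := by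
  have h₂ := nilW_pos τ v p
  exact le_trans (by positivity) (nilEnergy_ge τ u v p)

lemma nilBeta_eq_of_nilEnergy_eq_zero {τ : ℝ} {u v : ℝ × ℝ → ℝ} {p : ℝ × ℝ}
    (h : nilEnergy τ u v p = 0) : nilBeta τ u p = nilBeta τ v p := by
  have h₁ := nilW_pos τ u p
  have h₂ := nilW_pos τ v p
  rw [nilEnergy, nil_monotone h₁ h₂ (nilW_sq τ u p) (nilW_sq τ v p), mul_eq_zero] at h
  have h3 := h.resolve_left (by positivity)
  have h4 : 1 / nilW τ u p - 1 / nilW τ v p = 0 := by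
    refine pow_eq_zero_iff (two_ne_zero) |>.1 (le_antisymm ?_ (sq_nonneg _))
    nlinarith [sq_nonneg (nilAlpha τ u p / nilW τ u p - nilAlpha τ v p / nilW τ v p),
      sq_nonneg (nilBeta τ u p / nilW τ u p - nilBeta τ v p / nilW τ v p)]
  have h5 : nilBeta τ u p / nilW τ u p - nilBeta τ v p / nilW τ v p = 0 := by
    refine pow_eq_zero_iff (two_ne_zero) |>.1 (le_antisymm ?_ (sq_nonneg _))
    nlinarith [sq_nonneg (nilAlpha τ u p / nilW τ u p - nilAlpha τ v p / nilW τ v p),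
      sq_nonneg (1 / nilW τ u p - 1 / nilW τ v p)]
  have h6 : nilW τ u p = nilW τ v p := by
    rw [one_div, one_div, sub_eq_zero] at h4
    exact inv_injective h4
  rw [h6, sub_eq_zero] at h5
  exact (div_left_inj' h₂.ne').1 h5

lemma nilEnergy_eq_zero_of_lt {τ a b C ε : ℝ} (hab : a ≤ b) {Ω : Set (ℝ × ℝ)} (hΩo : IsOpen Ω)
    (hΩs : Ω ⊆ {p : ℝ × ℝ | p.2 ∈ Set.Ioo a b}) {u v : ℝ × ℝ → ℝ}
    (hu : ContDiffOn ℝ 2 u Ω) (hv : ContDiffOn ℝ 2 v Ω)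
    (hu0 : ContinuousOn u (closure Ω)) (hv0 : ContinuousOn v (closure Ω))
    (humin : NilMinimal τ u Ω) (hvmin : NilMinimal τ v Ω)
    (hbd : ∀ p ∈ frontier Ω, u p ≤ v p) (hC : 0 ≤ C)
    (hgrow : ∀ p ∈ Ω, v p < u p → (u p - v p) ^ 2 ≤ C * (1 + |p.1|) * nilW τ v p)
    (hε : 0 < ε) {p₀ : ℝ × ℝ} (hp₀ : p₀ ∈ Ω) (hlt : ε < u p₀ - v p₀) :
    nilEnergy τ u v p₀ = 0 := by
  have huC : ∀ p ∈ Ω, ContDiffAt ℝ 2 u p := fun p hp => hu.contDiffAt (hΩo.mem_nhds hp)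
  have hvC : ∀ p ∈ Ω, ContDiffAt ℝ 2 v p := fun p hp => hv.contDiffAt (hΩo.mem_nhds hp)
  set Y₁ : ℝ × ℝ → ℝ := fun q => nilAlpha τ u q / nilW τ u q - nilAlpha τ v q / nilW τ v q with hY₁
  set Y₂ : ℝ × ℝ → ℝ := fun q => nilBeta τ u q / nilW τ u q - nilBeta τ v q / nilW τ v q with hY₂
  have hY₁C : ∀ p ∈ Ω, ContDiffAt ℝ 1 Y₁ p := fun p hp =>
    (contDiffAt_nilAlpha_div (huC p hp)).sub (contDiffAt_nilAlpha_div (hvC p hp))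
  have hY₂C : ∀ p ∈ Ω, ContDiffAt ℝ 1 Y₂ p := fun p hp =>
    (contDiffAt_nilBeta_div (huC p hp)).sub (contDiffAt_nilBeta_div (hvC p hp))
  have hYdiv : ∀ p ∈ Ω, fderiv ℝ Y₁ p (1, 0) + fderiv ℝ Y₂ p (0, 1) = 0 := by
    intro p hp
    have h1 := humin p hp
    have h2 := hvmin p hp
    simp only [hY₁, hY₂]
    rw [fderiv_fun_sub ((contDiffAt_nilAlpha_div (huC p hp)).differentiableAt (by norm_num))
        ((contDiffAt_nilAlpha_div (hvC p hp)).differentiableAt (by norm_num)),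
      fderiv_fun_sub ((contDiffAt_nilBeta_div (huC p hp)).differentiableAt (by norm_num))
        ((contDiffAt_nilBeta_div (hvC p hp)).differentiableAt (by norm_num))]
    simp only [sub_apply]
    linarith
  by_contra hne
  set D₀ : ℝ × ℝ → ℝ := fun q => softPosDeriv (u q - v q - ε) * nilEnergy τ u v q with hD₀
  have hD₀pos : 0 < D₀ p₀ := mul_pos (softPosDeriv_pos (by linarith))
    (lt_of_le_of_ne (nilEnergy_nonneg τ u v p₀) (Ne.symm hne))
  have hD₀c : ContinuousAt D₀ p₀ := by
    have c1 := (huC p₀ hp₀).continuousAt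
    have c2 := (hvC p₀ hp₀).continuousAt
    have c3 : ContinuousAt (nilEnergy τ u v) p₀ :=
      (((contDiffAt_nilAlpha (huC p₀ hp₀)).continuousAt.sub
        (contDiffAt_nilAlpha (hvC p₀ hp₀)).continuousAt).mul (hY₁C p₀ hp₀).continuousAt).add
      (((contDiffAt_nilBeta (huC p₀ hp₀)).continuousAt.sub
        (contDiffAt_nilBeta (hvC p₀ hp₀)).continuousAt).mul (hY₂C p₀ hp₀).continuousAt)
    exact (continuous_softPosDeriv.continuousAt.comp
      ((c1.sub c2).sub continuousAt_const)).mul c3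
  obtain ⟨r, hr, hball⟩ := Metric.nhds_basis_closedBall.eventually_iff.1
    ((hΩo.eventually_mem hp₀).and (hD₀c.eventually (lt_mem_nhds (half_lt_self hD₀pos))))
  set S := Metric.closedBall p₀ r with hS
  have hvol : 0 < MeasureTheory.volume.real S := by
    rw [MeasureTheory.measureReal_def]
    exact ENNReal.toReal_pos (Metric.measure_closedBall_pos _ _ hr).ne'
      (isCompact_closedBall p₀ r).measure_lt_top.ne
  set X := |p₀.1| + r with hX
  have hSX : ∀ p ∈ S, |p.1| ≤ X := by
    intro p hp
    have h1 : dist p.1 p₀.1 ≤ r := (le_max_left _ _).trans hp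
    rw [Real.dist_eq] at h1
    have := abs_sub_abs_le_abs_sub p.1 p₀.1
    linarith
  -- the estimate for a large box
  have main : ∀ R : ℝ, 2 ≤ R → X ≤ R → 2 * X ^ 2 ≤ Real.log (1 + R ^ 2) →
      D₀ p₀ / 16 * MeasureTheory.volume.real S * Real.log (1 + R ^ 2) ≤ 64 * C * (b - a) := by
    intro R hR2 hRX hRlog
    set Λ := Real.log (1 + R ^ 2) with hΛ
    have hΛ0 : 0 < Λ := Real.log_pos (by nlinarith)
    set χ : ℝ → ℝ := fun x => max (1 - Real.log (1 + x ^ 2) / Λ) 0 ^ 2 with hχ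
    set G : ℝ × ℝ → ℝ := fun q => softPos (u q - v q - ε) * χ q.1 with hG
    have hGC : ∀ p ∈ Ω, ContDiffAt ℝ 1 G p := by
      intro p hp
      have c1 : ContDiffAt ℝ 1 (fun q => u q - v q - ε) p :=
        (((huC p hp).of_le (by norm_num)).sub ((hvC p hp).of_le (by norm_num))).sub
          contDiffAt_const
      exact (contDiff_softPos.contDiffAt.comp p c1).mul
        ((contDiff_logCutoff Λ).contDiffAt.comp p contDiffAt_fst)
    have hG0 : ∀ p ∈ frontier Ω, ∀ᶠ q in nhds p, q ∈ Ω → G q = 0 := by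
      intro p hp
      have hc : ContinuousWithinAt (fun q => u q - v q) (closure Ω) p :=
        (hu0.sub hv0) p hp.1
      have h1 : u p - v p < ε := by linarith [hbd p hp]
      filter_upwards [eventually_nhdsWithin_iff.1 (hc.eventually (gt_mem_nhds h1))] with q hq hqΩ
      have := hq (subset_closure hqΩ)
      simp only [hG]
      rw [softPos_of_nonpos (by linarith), zero_mul]
    obtain ⟨hZ₁C, hZ₁in, hZ₁out⟩ := contDiff_indicator_of_eventually_eq_zero hΩo
      (F := fun q => G q * Y₁ q) (fun p hp => (hGC p hp).mul (hY₁C p hp))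
      (fun p hp => (hG0 p hp).mono fun q h hq => by rw [h hq, zero_mul])
    obtain ⟨hZ₂C, hZ₂in, hZ₂out⟩ := contDiff_indicator_of_eventually_eq_zero hΩo
      (F := fun q => G q * Y₂ q) (fun p hp => (hGC p hp).mul (hY₂C p hp))
      (fun p hp => (hG0 p hp).mono fun q h hq => by rw [h hq, zero_mul])
    set D : ℝ × ℝ → ℝ := Ω.indicator (fun q => 1 / 2 * (χ q.1 * D₀ q)) with hD
    have hχR : χ R = 0 := by simp [hχ, ← hΛ, div_self hΛ0.ne']
    have hχR' : χ (-R) = 0 := by simp [hχ, ← hΛ, div_self hΛ0.ne']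
    have hD₀nn : ∀ q, 0 ≤ D₀ q := fun q =>
      mul_nonneg (softPosDeriv_nonneg _) (nilEnergy_nonneg τ u v q)
    have hdivle : ∀ p, D p ≤ fderiv ℝ (Ω.indicator fun q => G q * Y₁ q) p (1, 0) +
        fderiv ℝ (Ω.indicator fun q => G q * Y₂ q) p (0, 1) +
        32 * C / Λ ^ 2 * (√(1 + p.1 ^ 2))⁻¹ := by
      intro p
      by_cases hp : p ∈ Ω
      · rw [hZ₁in p hp, hZ₂in p hp, hD, Set.indicator_of_mem hp]
        have hdu := ((huC p hp).differentiableAt (by norm_num)).hasFDerivAt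
        have hdv := ((hvC p hp).differentiableAt (by norm_num)).hasFDerivAt
        have hGd : HasFDerivAt G _ p :=
          ((hasDerivAt_softPos _).comp_hasFDerivAt p ((hdu.sub hdv).sub_const ε)).mul
            ((hasDerivAt_logCutoff Λ p.1).comp_hasFDerivAt p hasFDerivAt_fst)
        have hd₁ := hGd.mul ((hY₁C p hp).differentiableAt (by norm_num)).hasFDerivAt
        have hd₂ := hGd.mul ((hY₂C p hp).differentiableAt (by norm_num)).hasFDerivAt
        have hf₁ : fderiv ℝ (fun q => G q * Y₁ q) p = _ := hd₁.fderiv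
        have hf₂ : fderiv ℝ (fun q => G q * Y₂ q) p = _ := hd₂.fderiv
        rw [hf₁, hf₂]
        have hs : max (u p - v p - ε) 0 ^ 2 ≤ C * (1 + |p.1|) * nilW τ v p := by
          have hW := nilW_pos τ v p
          rcases le_total (u p - v p - ε) 0 with h | h
          · rw [max_eq_right h]; simp only [ne_eq, OfNat.ofNat_ne_zero, not_false_eq_true, zero_pow]
            positivity
          · rw [max_eq_left h]
            refine le_trans ?_ (hgrow p hp (by linarith))
            exact pow_le_pow_left₀ h (by linarith) 2
        have hEn := energy_absorb (Λ := Λ) (softPos_nonneg (u p - v p - ε)) (softPos_le _)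
          (softPosDeriv_nonneg _) (softPosDeriv_le_one _)
          (le_max_right (1 - Real.log (1 + p.1 ^ 2) / Λ) 0) (nilW_pos τ v p) hC hs
          (nilEnergy_ge τ u v p)
        have hdiv0 := hYdiv p hp
        have ha : nilAlpha τ u p - nilAlpha τ v p =
            fderiv ℝ u p (1, 0) - fderiv ℝ v p (1, 0) := by simp only [nilAlpha]; ring
        have hb : nilBeta τ u p - nilBeta τ v p =
            fderiv ℝ u p (0, 1) - fderiv ℝ v p (0, 1) := by simp only [nilBeta]; ring
        have hen : nilEnergy τ u v p = (fderiv ℝ u p (1, 0) - fderiv ℝ v p (1, 0)) * Y₁ p +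
            (fderiv ℝ u p (0, 1) - fderiv ℝ v p (0, 1)) * Y₂ p := by
          rw [← ha, ← hb]; rfl
        have hD₀p : D₀ p = softPosDeriv (u p - v p - ε) * nilEnergy τ u v p := rfl
        simp only [add_apply, sub_apply, smul_apply, ContinuousLinearMap.coe_fst', smul_eq_mul]
        rw [hen] at hEn hD₀p
        simp only [Function.comp_apply, Pi.sub_apply]
        rw [hD₀p]
        simp only [hχ]
        linear_combination hEn - G p * hdiv0
      · rw [hZ₁out p hp, hZ₂out p hp, hD, Set.indicator_of_notMem hp]
        simp only [zero_apply, zero_add]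
        positivity
    have hmeas := measure_le_of_divergence hab (by linarith : 0 ≤ R) hZ₁C hZ₂C (D := D)
      (δ := D₀ p₀ / 16) (S := S) ?_ ?_ ?_ ?_ hdivle ?_ measurableSet_closedBall ?_ ?_
    · have h1 := arsinh_le_log hR2
      have h2 : 2 * (32 * C / Λ ^ 2) * (b - a) * Real.arsinh R ≤
          2 * (32 * C / Λ ^ 2) * (b - a) * Λ := by
        have : 0 ≤ b - a := by linarith
        gcongr
      calc D₀ p₀ / 16 * MeasureTheory.volume.real S * Λ
          ≤ 2 * (32 * C / Λ ^ 2) * (b - a) * Λ * Λ := 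
            mul_le_mul_of_nonneg_right (hmeas.trans h2) hΛ0.le
        _ = 64 * C * (b - a) := by field_simp; ring
    · intro y
      by_cases h : (R, y) ∈ Ω
      · simp [Set.indicator_of_mem h, hG, hχR]
      · exact Set.indicator_of_notMem h _
    · intro y
      by_cases h : (-R, y) ∈ Ω
      · simp [Set.indicator_of_mem h, hG, hχR']
      · exact Set.indicator_of_notMem h _
    · exact fun x => Set.indicator_of_notMem (fun h => lt_irrefl _ (hΩs h).1) _
    · exact fun x => Set.indicator_of_notMem (fun h => lt_irrefl _ (hΩs h).2) _
    · intro p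
      refine Set.indicator_nonneg (fun q _ => ?_) p
      have := hD₀nn q
      positivity
    · intro p hp
      have h1 := abs_le.1 ((hSX p hp).trans hRX)
      have h2 := hΩs (hball hp).1
      exact ⟨⟨h1.1, h2.1.le⟩, ⟨h1.2, h2.2.le⟩⟩
    · intro p hp
      have hpb := hball hp
      rw [hD, Set.indicator_of_mem hpb.1]
      have h1 : Real.log (1 + p.1 ^ 2) ≤ X ^ 2 := by
        have h2 := Real.log_le_sub_one_of_pos (by positivity : 0 < 1 + p.1 ^ 2)
        have h3 : p.1 ^ 2 ≤ X ^ 2 := by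
          rw [← sq_abs]; gcongr; exact hSX p hp
        linarith
      have h2 : 1 / 2 ≤ 1 - Real.log (1 + p.1 ^ 2) / Λ := by
        have : Real.log (1 + p.1 ^ 2) / Λ ≤ 1 / 2 := by
          rw [div_le_iff₀ hΛ0]; linarith
        linarith
      have h3 : 1 / 4 ≤ χ p.1 := by
        have : 1 / 2 ≤ max (1 - Real.log (1 + p.1 ^ 2) / Λ) 0 := h2.trans (le_max_left _ _)
        simp only [hχ]
        nlinarith
      have h4 := hpb.2
      nlinarith
  have htend : Filter.Tendsto (fun R : ℝ => Real.log (1 + R ^ 2)) Filter.atTop Filter.atTop :=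
    Real.tendsto_log_atTop.comp
      (Filter.tendsto_atTop_add_const_left _ _ (Filter.tendsto_pow_atTop two_ne_zero))
  have hm : 0 < D₀ p₀ / 16 * MeasureTheory.volume.real S := by positivity
  obtain ⟨R, hR1, hR2, hR3, hR4⟩ := ((Filter.eventually_ge_atTop (2 : ℝ)).and
    ((Filter.eventually_ge_atTop X).and ((htend.eventually_ge_atTop (2 * X ^ 2)).and
    (htend.eventually_gt_atTop (64 * C * (b - a) /
      (D₀ p₀ / 16 * MeasureTheory.volume.real S)))))).exists
  have h1 := main R hR1 hR2 hR3
  rw [div_lt_iff₀ hm] at hR4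
  linarith

/-- Moving upwards from a point of a domain in a horizontal strip, one meets the boundary. -/
lemma exists_vertical_exit {a b : ℝ} {Ω : Set (ℝ × ℝ)} (hΩo : IsOpen Ω)
    (hΩs : Ω ⊆ {p : ℝ × ℝ | p.2 ∈ Set.Ioo a b}) {p : ℝ × ℝ} (hp : p ∈ Ω) :
    ∃ t, p.2 < t ∧ (p.1, t) ∈ frontier Ω ∧ ∀ s ∈ Set.Ico p.2 t, (p.1, s) ∈ Ω := by
  set T : Set ℝ := {t | p.2 ≤ t ∧ (p.1, t) ∉ Ω} with hT
  have hcont : Continuous fun t : ℝ => (p.1, t) := by fun_prop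
  have hTc : IsClosed T := isClosed_Ici.inter (hΩo.preimage hcont).isClosed_compl
  have hTn : T.Nonempty := ⟨b, (hΩs hp).2.le, fun h => lt_irrefl _ (hΩs h).2⟩
  have hTb : BddBelow T := ⟨p.2, fun t ht => ht.1⟩
  have hmem := hTc.csInf_mem hTn hTb
  have hlt : p.2 < sInf T := by
    refine lt_of_le_of_ne hmem.1 fun h => hmem.2 ?_
    rw [← h]
    exact hp
  have hin : ∀ s ∈ Set.Ico p.2 (sInf T), (p.1, s) ∈ Ω := fun s hs => by
    by_contra h
    exact notMem_of_lt_csInf hs.2 hTb ⟨hs.1, h⟩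
  refine ⟨sInf T, hlt, ⟨?_, ?_⟩, hin⟩
  · have h1 : sInf T ∈ closure (Set.Ico p.2 (sInf T)) := by
      rw [closure_Ico hlt.ne]
      exact Set.right_mem_Icc.2 hlt.le
    exact map_mem_closure hcont h1 hin
  · rw [hΩo.interior_eq]
    exact hmem.2

/-- Comparison principle for minimal graphs over domains in a strip, for differences of
controlled growth. -/
lemma nil_le_of_frontier_le {τ a b C : ℝ} (hab : a ≤ b) {Ω : Set (ℝ × ℝ)} (hΩo : IsOpen Ω)
    (hΩs : Ω ⊆ {p : ℝ × ℝ | p.2 ∈ Set.Ioo a b}) {u v : ℝ × ℝ → ℝ}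
    (hu : ContDiffOn ℝ 2 u Ω) (hv : ContDiffOn ℝ 2 v Ω)
    (hu0 : ContinuousOn u (closure Ω)) (hv0 : ContinuousOn v (closure Ω))
    (humin : NilMinimal τ u Ω) (hvmin : NilMinimal τ v Ω)
    (hbd : ∀ p ∈ frontier Ω, u p ≤ v p) (hC : 0 ≤ C)
    (hgrow : ∀ p ∈ Ω, v p < u p → (u p - v p) ^ 2 ≤ C * (1 + |p.1|) * nilW τ v p) :
    ∀ p ∈ Ω, u p ≤ v p := by
  intro p hp
  by_contra! hlt
  have hβ : ∀ q ∈ Ω, v q < u q → fderiv ℝ u q (0, 1) = fderiv ℝ v q (0, 1) := by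
    intro q hq hq'
    have h := nilBeta_eq_of_nilEnergy_eq_zero (nilEnergy_eq_zero_of_lt hab hΩo hΩs hu hv hu0 hv0
      humin hvmin hbd hC hgrow (ε := (u q - v q) / 2) (by linarith) hq (by linarith))
    simp only [nilBeta] at h
    linarith
  obtain ⟨t, hpt, htf, hin⟩ := exists_vertical_exit hΩo hΩs hp
  have hcont : ContinuousOn (fun s : ℝ => max (u (p.1, s) - v (p.1, s)) 0 ^ 2)
      (Set.Icc p.2 t) := by
    have hm : Set.MapsTo (fun s : ℝ => (p.1, s)) (Set.Icc p.2 t) (closure Ω) := by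
      intro s hs
      rcases hs.2.lt_or_eq with h | h
      · exact subset_closure (hin s ⟨hs.1, h⟩)
      · rw [h]; exact htf.1
    have hl : ContinuousOn (fun s : ℝ => (p.1, s)) (Set.Icc p.2 t) := by fun_prop
    exact (((hu0.comp hl hm).sub (hv0.comp hl hm)).sup continuousOn_const).pow 2
  have hder : ∀ s ∈ Set.Ioo p.2 t,
      HasDerivAt (fun s : ℝ => max (u (p.1, s) - v (p.1, s)) 0 ^ 2) 0 s := by
    intro s hs
    have hsΩ := hin s ⟨hs.1.le, hs.2⟩
    have hl : HasDerivAt (fun s : ℝ => (p.1, s)) ((0, 1) : ℝ × ℝ) s :=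
      (hasDerivAt_const s p.1).prodMk (hasDerivAt_id s)
    have hdu := ((hu.contDiffAt (hΩo.mem_nhds hsΩ)).differentiableAt (by norm_num)).hasFDerivAt
    have hdv := ((hv.contDiffAt (hΩo.mem_nhds hsΩ)).differentiableAt (by norm_num)).hasFDerivAt
    have h := (hasDerivAt_posPart_sq (u (p.1, s) - v (p.1, s))).comp s
      ((hdu.comp_hasDerivAt s hl).sub (hdv.comp_hasDerivAt s hl))
    refine h.congr_deriv ?_
    rcases le_or_gt (u (p.1, s)) (v (p.1, s)) with hle | hgt
    · rw [max_eq_right (by linarith), mul_zero, zero_mul]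
    · rw [hβ _ hsΩ hgt, sub_self, mul_zero]
  obtain ⟨s, -, hs⟩ := exists_hasDerivAt_eq_slope _ _ hpt hcont hder
  have hne : t - p.2 ≠ 0 := by linarith
  rw [eq_comm, div_eq_zero_iff, or_iff_left hne, max_eq_right (by linarith [hbd _ htf]),
    max_eq_left (by linarith : 0 ≤ u (p.1, p.2) - v (p.1, p.2))] at hs
  have : 0 < u p - v p := by linarith
  have h2 : (u p - v p) ^ 2 = 0 := by
    have : (u (p.1, p.2) - v (p.1, p.2)) ^ 2 = 0 := by linarith
    exact this
  nlinarith

lemma nilMinimal_const (τ M : ℝ) (Ω : Set (ℝ × ℝ)) : NilMinimal τ (fun _ => M) Ω := by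
  intro p _
  rw [nil_divergence_eq contDiffAt_const]
  have h : fderiv ℝ (fun _ : ℝ × ℝ => M) = fun _ => 0 := by
    ext1 q
    exact fderiv_const_apply M
  simp [secondDeriv, h]

lemma nil_le_of_frontier_le_const {τ a b M : ℝ} (hab : a ≤ b) {Ω : Set (ℝ × ℝ)}
    (hΩo : IsOpen Ω) (hΩs : Ω ⊆ {p : ℝ × ℝ | p.2 ∈ Set.Ioo a b}) {u : ℝ × ℝ → ℝ}
    (hu : ContDiffOn ℝ 2 u Ω) (hu0 : ContinuousOn u (closure Ω)) (humin : NilMinimal τ u Ω)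
    (hM : ∀ p ∈ frontier Ω, u p ≤ M) : ∀ p ∈ Ω, u p ≤ M := by
  obtain ⟨C, hC, hlin⟩ := nil_le_add_linear hΩo hΩs hu hu0 humin hM
  refine nil_le_of_frontier_le (v := fun _ => M) (C := 2 * C ^ 2 * (1 + |τ|)) hab hΩo hΩs hu
    contDiffOn_const hu0 continuousOn_const humin (nilMinimal_const τ M Ω) hM (by positivity) ?_
  intro p hp hlt
  have hWpos := nilW_pos τ (fun _ => M) p
  have hWsq : nilW τ (fun _ => M) p ^ 2 = 1 + (τ * p.2) ^ 2 + (τ * p.1) ^ 2 := by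
    rw [nilW_sq]
    simp [nilAlpha, nilBeta]
  have hx := abs_nonneg p.1
  have ht := abs_nonneg τ
  set L := 1 + |τ| * |p.1| with hL
  have hL0 : 0 < L := by positivity
  have hW : L ≤ 2 * nilW τ (fun _ => M) p := by
    refine abs_le_of_sq_le_sq' ?_ (by positivity) |>.2
    have : (τ * p.1) ^ 2 = (|τ| * |p.1|) ^ 2 := by rw [← abs_mul, sq_abs]
    nlinarith [sq_nonneg (|τ| * |p.1| - 1), sq_nonneg (τ * p.2)]
  have hL2 : L ≤ (1 + |τ|) * (1 + |p.1|) := by nlinarith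
  have h1 : (u p - M) ^ 2 ≤ (C * L) ^ 2 :=
    pow_le_pow_left₀ (by linarith) (by linarith [hlin p hp]) 2
  have h2 : L * L ≤ (1 + |τ|) * (1 + |p.1|) * (2 * nilW τ (fun _ => M) p) :=
    mul_le_mul hL2 hW hL0.le (by positivity)
  calc (u p - M) ^ 2 ≤ C ^ 2 * (L * L) := by linarith
    _ ≤ C ^ 2 * ((1 + |τ|) * (1 + |p.1|) * (2 * nilW τ (fun _ => M) p)) := by gcongr
    _ = _ := by ring

lemma nil_lt_of_frontier_lt {τ a b M : ℝ} (hab : a ≤ b) {Ω : Set (ℝ × ℝ)}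
    (hΩo : IsOpen Ω) (hΩc : IsPreconnected Ω) (hΩs : Ω ⊆ {p : ℝ × ℝ | p.2 ∈ Set.Ioo a b})
    {u : ℝ × ℝ → ℝ} (hu : ContDiffOn ℝ 2 u Ω) (hu0 : ContinuousOn u (closure Ω))
    (humin : NilMinimal τ u Ω) (hM : ∀ p ∈ frontier Ω, u p < M) : ∀ p ∈ Ω, u p < M := by
  have hle := nil_le_of_frontier_le_const hab hΩo hΩs hu hu0 humin fun p hp => (hM p hp).le
  intro p hp
  refine (hle p hp).lt_of_ne fun h => ?_
  have heq := nil_strong_maximum hΩo hΩc hu humin hle hp h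
  obtain ⟨t, -, htf, -⟩ := exists_vertical_exit hΩo hΩs hp
  have hcl : Set.EqOn u (fun _ => M) (closure Ω) :=
    Set.EqOn.of_subset_closure heq hu0 continuousOn_const subset_closure subset_rfl
  exact (hM _ htf).ne (hcl htf.1)

lemma NilMinimal.neg {τ : ℝ} {u : ℝ × ℝ → ℝ} {Ω : Set (ℝ × ℝ)} (h : NilMinimal τ u Ω) :
    NilMinimal (-τ) (fun p => -u p) Ω := by
  have hα : ∀ q, nilAlpha (-τ) (fun p => -u p) q = -nilAlpha τ u q := fun q => by
    simp only [nilAlpha, fderiv_fun_neg, neg_apply]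
    ring
  have hβ : ∀ q, nilBeta (-τ) (fun p => -u p) q = -nilBeta τ u q := fun q => by
    simp only [nilBeta, fderiv_fun_neg, neg_apply]
    ring
  have hW : ∀ q, nilW (-τ) (fun p => -u p) q = nilW τ u q := fun q => by
    simp only [nilW, hα, hβ, neg_sq]
  intro p hp
  simp only [hα, hβ, hW, neg_div, fderiv_fun_neg, neg_apply]
  linarith [h p hp]

lemma one_le_nilW (τ : ℝ) (u : ℝ × ℝ → ℝ) (p : ℝ × ℝ) : 1 ≤ nilW τ u p :=
  Real.one_le_sqrt.2 (by nlinarith [sq_nonneg (nilAlpha τ u p), sq_nonneg (nilBeta τ u p)])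

/-- A minimal graph over a connected domain in a strip stays strictly between the bounds of its
boundary values. -/
lemma nil_bounds_of_frontier_bounds {τ a b m M : ℝ} (hab : a ≤ b) {Ω : Set (ℝ × ℝ)}
    (hΩo : IsOpen Ω) (hΩc : IsPreconnected Ω) (hΩs : Ω ⊆ {p : ℝ × ℝ | p.2 ∈ Set.Ioo a b})
    {u : ℝ × ℝ → ℝ} (hu : ContDiffOn ℝ 2 u Ω) (hu0 : ContinuousOn u (closure Ω))
    (humin : NilMinimal τ u Ω) (hm : ∀ p ∈ frontier Ω, m < u p)
    (hM : ∀ p ∈ frontier Ω, u p < M) : ∀ p ∈ Ω, m < u p ∧ u p < M := fun p hp =>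
  ⟨neg_lt_neg_iff.1 (nil_lt_of_frontier_lt hab hΩo hΩc hΩs hu.neg hu0.neg humin.neg
      (fun q hq => neg_lt_neg (hm q hq)) p hp),
    nil_lt_of_frontier_lt hab hΩo hΩc hΩs hu hu0 humin hM p hp⟩

/-- Comparison principle for bounded minimal graphs over domains in a strip. -/
lemma nil_le_of_frontier_le_of_bounded {τ a b m M : ℝ} (hab : a ≤ b) {Ω : Set (ℝ × ℝ)}
    (hΩo : IsOpen Ω) (hΩs : Ω ⊆ {p : ℝ × ℝ | p.2 ∈ Set.Ioo a b}) {u v : ℝ × ℝ → ℝ}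
    (hu : ContDiffOn ℝ 2 u Ω) (hv : ContDiffOn ℝ 2 v Ω)
    (hu0 : ContinuousOn u (closure Ω)) (hv0 : ContinuousOn v (closure Ω))
    (humin : NilMinimal τ u Ω) (hvmin : NilMinimal τ v Ω)
    (hbd : ∀ p ∈ frontier Ω, u p ≤ v p) (huM : ∀ p ∈ Ω, u p ≤ M) (hvm : ∀ p ∈ Ω, m ≤ v p) :
    ∀ p ∈ Ω, u p ≤ v p := by
  refine nil_le_of_frontier_le hab hΩo hΩs hu hv hu0 hv0 humin hvmin hbd
    (sq_nonneg (M - m)) fun p hp hlt => ?_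
  have h1 : (u p - v p) ^ 2 ≤ (M - m) ^ 2 :=
    pow_le_pow_left₀ (by linarith) (by linarith [huM p hp, hvm p hp]) 2
  have hW := one_le_nilW τ v p
  calc (u p - v p) ^ 2 ≤ (M - m) ^ 2 * 1 * 1 := by linarith
    _ ≤ (M - m) ^ 2 * (1 + |p.1|) * nilW τ v p := by
      gcongr
      linarith [abs_nonneg p.1]

/-- Corollary 5.3: uniqueness of the solution of the Dirichlet problem for the
`Nil₃(τ)` minimal graph equation with bounded boundary values over a convex domain
contained in a strip; moreover the solution stays between the boundary bounds. -/
theorem nil3_strip_dirichlet_uniqueness (τ a b : ℝ) (hab : a < b)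
    (Ω : Set (ℝ × ℝ)) (hΩo : IsOpen Ω) (hΩc : Convex ℝ Ω)
    (hΩs : Ω ⊆ {p : ℝ × ℝ | p.2 ∈ Set.Ioo a b})
    (φ : ℝ × ℝ → ℝ) (hφ : ContinuousOn φ (frontier Ω))
    (m M : ℝ) (hφm : ∀ p ∈ frontier Ω, m < φ p) (hφM : ∀ p ∈ frontier Ω, φ p < M)
    (u v : ℝ × ℝ → ℝ)
    (hu : ContDiffOn ℝ 2 u Ω) (hv : ContDiffOn ℝ 2 v Ω)
    (hu0 : ContinuousOn u (closure Ω)) (hv0 : ContinuousOn v (closure Ω))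
    (humin : NilMinimal τ u Ω) (hvmin : NilMinimal τ v Ω)
    (hubd : ∀ p ∈ frontier Ω, u p = φ p) (hvbd : ∀ p ∈ frontier Ω, v p = φ p) :
    (∀ p ∈ Ω, u p = v p) ∧ ∀ p ∈ Ω, m < u p ∧ u p < M := by
  have huB := nil_bounds_of_frontier_bounds hab.le hΩo hΩc.isPreconnected hΩs hu hu0 humin
    (fun p hp => hubd p hp ▸ hφm p hp) (fun p hp => hubd p hp ▸ hφM p hp)
  have hvB := nil_bounds_of_frontier_bounds hab.le hΩo hΩc.isPreconnected hΩs hv hv0 hvmin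
    (fun p hp => hvbd p hp ▸ hφm p hp) (fun p hp => hvbd p hp ▸ hφM p hp)
  refine ⟨fun p hp => le_antisymm ?_ ?_, huB⟩
  · exact nil_le_of_frontier_le_of_bounded hab.le hΩo hΩs hu hv hu0 hv0 humin hvmin
      (fun q hq => (hubd q hq).trans_le (hvbd q hq).ge) (fun q hq => (huB q hq).2.le)
      (fun q hq => (hvB q hq).1.le) p hp
  · exact nil_le_of_frontier_le_of_bounded hab.le hΩo hΩs hv hu hv0 hu0 hvmin humin
      (fun q hq => (hvbd q hq).trans_le (hubd q hq).ge) (fun q hq => (hvB q hq).2.le)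
      (fun q hq => (huB q hq).1.le) p hp

end
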